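/- Let n ≥ 5, t ≥ 1 and n ≥ 2t + 1, and let G be a cactus with n vertices and exactly t cycles such that W_e(G) ≥ W_e(H) for every cactus H with n vertices and exactly t cycles. Then G is a chain cactus, i.e., each block of G has at most two cut vertices of G and each cut vertex of G lies in exactly two blocks. -/

import Mathlib

open SimpleGraph Finset
open scoped Classical

/-- The distance `d_G(f,g)` between two edges: `0` if they coincide, otherwise the minimum
distance between endpoints plus one (i.e. the distance in the line graph). -/
noncomputable def eDist {V : Type*} (G : SimpleGraph V) (e f : Sym2 V) : ℕ :=
  if e = f then 0 else sInf {n : ℕ | ∃ u ∈ e, ∃ w ∈ f, G.dist u w = n} + 1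

/-- The distance `d_G(v,f)` between a vertex and an edge: the minimum distance to an endpoint. -/
noncomputable def vDist {V : Type*} (G : SimpleGraph V) (v : V) (e : Sym2 V) : ℕ :=
  sInf {n : ℕ | ∃ u ∈ e, G.dist v u = n}

/-- The edge-Wiener index `W_e(G)`: the sum of `eDist` over unordered pairs of edges. -/
noncomputable def edgeWiener {V : Type*} [Fintype V] (G : SimpleGraph V) : ℕ :=
  (∑ e ∈ G.edgeFinset, ∑ f ∈ G.edgeFinset, eDist G e f) / 2

/-- A cactus: a connected simple graph in which any two distinct cycles (distinguished by
their edge sets) share at most one vertex. -/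
def IsCactus {V : Type*} (G : SimpleGraph V) : Prop :=
  G.Connected ∧ ∀ (u w : V) (c1 : G.Walk u u) (c2 : G.Walk w w),
    c1.IsCycle → c2.IsCycle → c1.edges.toFinset ≠ c2.edges.toFinset →
      (c1.support.toFinset ∩ c2.support.toFinset).card ≤ 1

/-- `v` is a cut vertex of the connected graph `G`: deleting it disconnects the graph. -/
def IsCutVertex {V : Type} (G : SimpleGraph V) (v : V) : Prop :=
  ¬ (G.induce {u | u ≠ v}).Connected

/-- Two edges lie in a common block: they are equal or lie on a common cycle. -/
def SameBlock {V : Type} (G : SimpleGraph V) (e f : Sym2 V) : Prop :=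
  e = f ∨ ∃ (v : V) (c : G.Walk v v), c.IsCycle ∧ e ∈ c.edges ∧ f ∈ c.edges

/-- `B` is the edge set of a block of `G`: the set of edges sharing a block
with some fixed edge. -/
def IsBlockEdges {V : Type} (G : SimpleGraph V) (B : Set (Sym2 V)) : Prop :=
  ∃ e ∈ G.edgeSet, B = {f ∈ G.edgeSet | SameBlock G e f}


namespace S16

/-- weak homomorphisms map walks to walks that are not longer -/
lemma weak_walk {V W : Type} {G : SimpleGraph V} {G' : SimpleGraph W} (f : V → W)
    (hf : ∀ x y, G.Adj x y → f x = f y ∨ G'.Adj (f x) (f y)) {x y : V} (p : G.Walk x y) :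
    ∃ q : G'.Walk (f x) (f y), q.length ≤ p.length := by
  induction p with
  | nil => exact ⟨Walk.nil, le_rfl⟩
  | cons h p ih =>
    obtain ⟨q, hq⟩ := ih
    rcases hf _ _ h with h' | h'
    · exact ⟨q.copy h'.symm rfl, by simp; omega⟩
    · exact ⟨Walk.cons h' q, by simpa using hq⟩

lemma weak_reach {V W : Type} {G : SimpleGraph V} {G' : SimpleGraph W} (f : V → W)
    (hf : ∀ x y, G.Adj x y → f x = f y ∨ G'.Adj (f x) (f y)) {x y : V} (h : G.Reachable x y) :
    G'.Reachable (f x) (f y) := by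
  obtain ⟨p⟩ := h
  obtain ⟨q, -⟩ := weak_walk f hf p
  exact ⟨q⟩

lemma weak_dist {V W : Type} {G : SimpleGraph V} {G' : SimpleGraph W} (f : V → W)
    (hf : ∀ x y, G.Adj x y → f x = f y ∨ G'.Adj (f x) (f y)) {x y : V} (h : G.Reachable x y) :
    G'.dist (f x) (f y) ≤ G.dist x y := by
  obtain ⟨p, hp⟩ := h.exists_walk_length_eq_dist
  obtain ⟨q, hq⟩ := weak_walk f hf p
  exact (dist_le q).trans (hq.trans hp.le)

lemma lip_dist {V : Type} {G : SimpleGraph V} (hG : G.Connected) (l : V → ℕ)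
    (hl : ∀ x y, G.Adj x y → l x ≤ l y + 1) (x y : V) : l x ≤ l y + G.dist x y := by
  obtain ⟨p, hp⟩ := hG.exists_walk_length_eq_dist x y
  rw [← hp]
  clear hp
  induction p with
  | nil => simp
  | cons h p ih => have := hl _ _ h; simp; omega

/-- edges leaving `A` go only to `v` -/
def Closed {V : Type} (G : SimpleGraph V) (A : Set V) (v : V) : Prop :=
  v ∉ A ∧ ∀ x y, G.Adj x y → x ∈ A → y ∉ A → y = v

lemma Closed.mem_support {V : Type} {G : SimpleGraph V} {A : Set V} {v : V} (h : Closed G A v)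
    {x y : V} (p : G.Walk x y) (hx : x ∈ A) (hy : y ∉ A) : v ∈ p.support := by
  induction p with
  | nil => exact absurd hx hy
  | @cons a b c hab p ih =>
    by_cases hb : b ∈ A
    · simp [ih hb hy]
    · have := h.2 _ _ hab hx hb
      subst this
      simp

lemma Closed.dist {V : Type} {G : SimpleGraph V} {A : Set V} {v : V} (h : Closed G A v)
    (hG : G.Connected) {x y : V} (hx : x ∈ A) (hy : y ∉ A) :
    G.dist x y = G.dist x v + G.dist v y := by
  apply le_antisymm hG.dist_triangle
  obtain ⟨p, hp⟩ := hG.exists_walk_length_eq_dist x y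
  have hv := h.mem_support p hx hy
  have h1 := dist_le (p.takeUntil v hv)
  have h2 := dist_le (p.dropUntil v hv)
  have h3 := congrArg Walk.length (p.take_spec hv)
  rw [Walk.length_append] at h3
  omega

lemma Closed.cycle {V : Type} {G : SimpleGraph V} {A : Set V} {v : V} (h : Closed G A v)
    {u x y : V} (c : G.Walk u u) (hc : c.IsCycle) (hx : x ∈ c.support) (hxA : x ∈ A)
    (hy : y ∈ c.support) : y ∈ A ∨ y = v := by
  by_contra hcon
  push Not at hcon
  obtain ⟨hyA, hyv⟩ := hcon
  have hc' := hc.rotate hx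
  have hy' : y ∈ (c.rotate x hx).support := (c.mem_support_rotate_iff x hx).2 hy
  set d := c.rotate x hx with hd
  have h1 : v ∈ (d.takeUntil y hy').support := h.mem_support _ hxA hyA
  have h2 : v ∈ (d.dropUntil y hy').reverse.support := h.mem_support _ hxA hyA
  rw [Walk.support_reverse, List.mem_reverse] at h2
  have hn := hc'.support_nodup
  rw [← d.take_spec hy', Walk.tail_support_append, List.nodup_append] at hn
  have hxv : v ≠ x := fun e => h.1 (e ▸ hxA)
  have h1' : v ∈ (d.takeUntil y hy').support.tail := by
    rw [Walk.mem_support_iff] at h1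
    exact h1.resolve_left hxv
  have h2' : v ∈ (d.dropUntil y hy').support.tail := by
    rw [Walk.mem_support_iff] at h2
    exact h2.resolve_left (fun e => hyv e.symm)
  have hfin := hn.2.2 _ h1' _ h2' rfl
  exact hfin

/-- a nonempty closed set contains a neighbour of its gate -/
lemma Closed.exists_adj {V : Type} {G : SimpleGraph V} {A : Set V} {v : V} (h : Closed G A v)
    (hG : G.Connected) (hA : A.Nonempty) : ∃ x ∈ A, G.Adj x v := by
  obtain ⟨a, ha⟩ := hA
  obtain ⟨p⟩ := hG a v
  have : ∀ {a b : V} (p : G.Walk a b), a ∈ A → b ∉ A → ∃ x ∈ A, G.Adj x v := by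
    intro a b p
    induction p with
    | nil => intro h1 h2; exact absurd h1 h2
    | @cons a b c hab p ih =>
      intro h1 h2
      by_cases hb : b ∈ A
      · exact ih hb h2
      · have := h.2 _ _ hab h1 hb
        subst this
        exact ⟨_, h1, hab⟩
  exact this p ha h.1

/-! distances of edges -/

lemma eDist_le {V : Type} (G : SimpleGraph V) {e f : Sym2 V} {u w : V} (hu : u ∈ e) (hw : w ∈ f) :
    eDist G e f ≤ G.dist u w + 1 := by
  unfold eDist
  split_ifs
  · omega
  · exact Nat.add_le_add_right (Nat.sInf_le (show _ ∈ {n : ℕ | ∃ u ∈ e, ∃ w ∈ f, G.dist u w = n} from ⟨u, hu, w, hw, rfl⟩)) 1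

lemma sym2_nonempty {V : Type} (e : Sym2 V) : ∃ u, u ∈ e := by
  induction e using Sym2.ind with
  | _ x y => exact ⟨x, by simp⟩

lemma le_eDist {V : Type} (G : SimpleGraph V) {e f : Sym2 V} {n : ℕ} (hne : e ≠ f)
    (h : ∀ u ∈ e, ∀ w ∈ f, n ≤ G.dist u w) : n + 1 ≤ eDist G e f := by
  unfold eDist
  rw [if_neg hne]
  apply Nat.add_le_add_right
  obtain ⟨u, hu⟩ := sym2_nonempty e
  obtain ⟨w, hw⟩ := sym2_nonempty f
  have hne : {n : ℕ | ∃ u ∈ e, ∃ w ∈ f, G.dist u w = n}.Nonempty := ⟨_, u, hu, w, hw, rfl⟩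
  obtain ⟨u', hu', w', hw', h'⟩ := Nat.sInf_mem hne
  rw [← h']
  exact h _ hu' _ hw'

lemma eDist_exists {V : Type} (G : SimpleGraph V) {e f : Sym2 V} (hne : e ≠ f) :
    ∃ u ∈ e, ∃ w ∈ f, eDist G e f = G.dist u w + 1 := by
  unfold eDist
  rw [if_neg hne]
  obtain ⟨u, hu⟩ := sym2_nonempty e
  obtain ⟨w, hw⟩ := sym2_nonempty f
  have hne : {n : ℕ | ∃ u ∈ e, ∃ w ∈ f, G.dist u w = n}.Nonempty := ⟨_, u, hu, w, hw, rfl⟩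
  obtain ⟨u', hu', w', hw', h'⟩ := Nat.sInf_mem hne
  exact ⟨u', hu', w', hw', by rw [h']⟩

lemma eDist_self {V : Type} (G : SimpleGraph V) (e : Sym2 V) : eDist G e e = 0 := by
  simp [eDist]

lemma eDist_comm {V : Type} (G : SimpleGraph V) (e f : Sym2 V) : eDist G e f = eDist G f e := by
  by_cases h : e = f
  · rw [h]
  · apply le_antisymm
    · obtain ⟨u, hu, w, hw, h'⟩ := eDist_exists G (Ne.symm h)
      rw [h', dist_comm]
      exact eDist_le G hw hu
    · obtain ⟨u, hu, w, hw, h'⟩ := eDist_exists G h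
      rw [h', dist_comm]
      exact eDist_le G hw hu

lemma vDist_le {V : Type} (G : SimpleGraph V) {v : V} {f : Sym2 V} {w : V} (hw : w ∈ f) :
    vDist G v f ≤ G.dist v w := Nat.sInf_le ⟨w, hw, rfl⟩

lemma vDist_exists {V : Type} (G : SimpleGraph V) (v : V) (f : Sym2 V) :
    ∃ w ∈ f, vDist G v f = G.dist v w := by
  obtain ⟨w, hw⟩ := sym2_nonempty f
  have hne : {n : ℕ | ∃ u ∈ f, G.dist v u = n}.Nonempty := ⟨_, w, hw, rfl⟩
  obtain ⟨u', hu', h'⟩ := Nat.sInf_mem hne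
  exact ⟨u', hu', h'.symm⟩

lemma vDist_triangle {V : Type} {G : SimpleGraph V} (hG : G.Connected) (u v : V) (f : Sym2 V) :
    vDist G u f ≤ G.dist u v + vDist G v f := by
  obtain ⟨w, hw, h⟩ := vDist_exists G v f
  rw [h]
  exact (vDist_le G hw).trans hG.dist_triangle

/-- gate lemma for edges outside a closed set -/
lemma Closed.vDist {V : Type} {G : SimpleGraph V} {A : Set V} {v : V} (h : Closed G A v)
    (hG : G.Connected) {x : V} (hx : x ∈ A) {f : Sym2 V} (hf : ∀ w ∈ f, w ∉ A) :
    vDist G x f = G.dist x v + vDist G v f := by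
  apply le_antisymm (vDist_triangle hG _ _ _)
  obtain ⟨w, hw, h'⟩ := vDist_exists G x f
  rw [h', h.dist hG hx (hf w hw)]
  exact Nat.add_le_add_left (vDist_le G hw) _

/-- gate lemma for edges inside a closed set -/
lemma Closed.vDist' {V : Type} {G : SimpleGraph V} {A : Set V} {v : V} (h : Closed G A v)
    (hG : G.Connected) {x : V} (hx : x ∉ A) {f : Sym2 V} (hf : ∀ w ∈ f, w ∈ A ∨ w = v) :
    _root_.vDist G x f = G.dist x v + _root_.vDist G v f := by
  apply le_antisymm (vDist_triangle hG _ _ _)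
  obtain ⟨w, hw, h'⟩ := vDist_exists G x f
  rw [h']
  rcases hf w hw with hA | rfl
  · have h1 := h.dist hG hA hx
    have h2 := vDist_le G (v := v) hw
    rw [dist_comm] at h1
    rw [h1, dist_comm (u := w), dist_comm (u := x)]
    omega
  · have := vDist_le G (v := w) hw
    simp at this
    omega

/-! cactus facts -/

/-- the cycle condition in the definition of a cactus -/
def Cac {V : Type} (G : SimpleGraph V) : Prop :=
  ∀ (u w : V) (c1 : G.Walk u u) (c2 : G.Walk w w),
    c1.IsCycle → c2.IsCycle → c1.edges.toFinset ≠ c2.edges.toFinset →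
      (c1.support.toFinset ∩ c2.support.toFinset).card ≤ 1

lemma Cac.edges_eq {V : Type} {G : SimpleGraph V} (hG : Cac G) {u w : V} {c1 : G.Walk u u}
    {c2 : G.Walk w w} (h1 : c1.IsCycle) (h2 : c2.IsCycle) {x y : V} (hxy : x ≠ y)
    (hx1 : x ∈ c1.support) (hx2 : x ∈ c2.support) (hy1 : y ∈ c1.support) (hy2 : y ∈ c2.support)
    (e : Sym2 V) : e ∈ c1.edges ↔ e ∈ c2.edges := by
  have : c1.edges.toFinset = c2.edges.toFinset := by
    by_contra hne
    have := hG _ _ c1 c2 h1 h2 hne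
    rw [Finset.card_le_one] at this
    exact hxy (this x (by simp [hx1, hx2]) y (by simp [hy1, hy2]))
  rw [← List.mem_toFinset, this, List.mem_toFinset]

lemma cyc_exists {V : Type} {G : SimpleGraph V} {x a b : V} (ha : G.Adj x a) (hb : G.Adj x b)
    (hab : a ≠ b) (p : G.Walk a b) (hp : x ∉ p.support) :
    ∃ c : G.Walk x x, c.IsCycle ∧ s(x, a) ∈ c.edges ∧ s(x, b) ∈ c.edges := by
  have hx : x ∉ p.bypass.support := fun h => hp (p.support_bypass_subset_support h)
  refine ⟨Walk.cons ha (p.bypass.concat hb.symm), ?_, ?_, ?_⟩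
  · rw [Walk.cons_isCycle_iff]
    refine ⟨(Walk.concat_isPath_iff _).2 ⟨p.bypass_isPath, hx⟩, ?_⟩
    rw [Walk.edges_concat, List.concat_eq_append, List.mem_append]
    rintro (h | h)
    · exact hx (Walk.fst_mem_support_of_mem_edges _ h)
    · simp at h
      rcases h with h | h
      · exact ha.ne h.2.symm
      · exact hab h
  · simp
  · simp [Walk.edges_concat, Sym2.eq_swap]

/-- a vertex of a cycle has a cycle edge, and the rest of the cycle is connected -/
lemma cyc_rest {V : Type} {G : SimpleGraph V} {u p : V} {c : G.Walk u u} (hc : c.IsCycle)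
    (hp : p ∈ c.support) : ∃ s, ∃ _ : G.Adj p s, s(p, s) ∈ c.edges ∧ ∀ q ∈ c.support, q ≠ p →
      ∃ w : G.Walk q s, p ∉ w.support := by
  have hc' := hc.rotate hp
  have hsup : ∀ q, q ∈ (c.rotate p hp).support ↔ q ∈ c.support :=
    fun q => c.mem_support_rotate_iff p hp
  have hed : ∀ e, e ∈ (c.rotate p hp).edges ↔ e ∈ c.edges :=
    fun e => (c.rotate_edges p hp).mem_iff
  generalize c.rotate p hp = d at *
  cases d with
  | nil => simp at hc'
  | @cons _ s _ h t =>
    rw [Walk.cons_isCycle_iff] at hc'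
    refine ⟨s, h, (hed _).1 (by simp), fun q hq hqp => ?_⟩
    have hqt : q ∈ t.support := by
      have := (hsup q).2 hq
      simp at this
      exact this.resolve_left hqp
    refine ⟨(t.takeUntil q hqt).reverse, ?_⟩
    rw [Walk.support_reverse, List.mem_reverse]
    exact Walk.endpoint_notMem_support_takeUntil hc'.1 hqt hqp.symm

/-- no ear on a cycle of a cactus -/
lemma Cac.no_ear {V : Type} {G : SimpleGraph V} (hG : Cac G) {u p q y : V} {c : G.Walk u u}
    (hc : c.IsCycle) (hp : p ∈ c.support) (hq : q ∈ c.support) (hpq : p ≠ q)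
    (hy : G.Adj p y) (hyc : s(p, y) ∉ c.edges) (w : G.Walk y q) (hw : p ∉ w.support) : False := by
  obtain ⟨s, hs, hse, hrest⟩ := cyc_rest hc hp
  obtain ⟨w2, hw2⟩ := hrest q hq hpq.symm
  have hys : y ≠ s := by rintro rfl; exact hyc hse
  obtain ⟨d, hd, h1, h2⟩ := cyc_exists hy hs hys (w.append w2) (by
    rw [Walk.mem_support_append_iff]; tauto)
  have := hG.edges_eq hc hd hs.ne hp (Walk.fst_mem_support_of_mem_edges _ h2)
    (Walk.snd_mem_support_of_mem_edges _ hse) (Walk.snd_mem_support_of_mem_edges _ h2) s(p, y)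
  exact hyc (this.2 h1)

/-- if the neighbours of `x` are connected outside `x`, there are at most two -/
lemma Cac.deg_le_two {V : Type} {G : SimpleGraph V} (hG : Cac G) {x r : V}
    (h : ∀ y, G.Adj x y → ∃ w : G.Walk y r, x ∉ w.support) {y1 y2 y3 : V}
    (h1 : G.Adj x y1) (h2 : G.Adj x y2) (h3 : G.Adj x y3) (h12 : y1 ≠ y2) (h13 : y1 ≠ y3)
    (h23 : y2 ≠ y3) : False := by
  obtain ⟨w1, hw1⟩ := h y1 h1
  obtain ⟨w2, hw2⟩ := h y2 h2
  obtain ⟨w3, hw3⟩ := h y3 h3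
  obtain ⟨c, hc, hc1, hc2⟩ := cyc_exists h1 h2 h12 (w1.append w2.reverse) (by
    rw [Walk.mem_support_append_iff, Walk.support_reverse, List.mem_reverse]; tauto)
  obtain ⟨d, hd, hd1, hd3⟩ := cyc_exists h1 h3 h13 (w1.append w3.reverse) (by
    rw [Walk.mem_support_append_iff, Walk.support_reverse, List.mem_reverse]; tauto)
  have hc3 : s(x, y3) ∈ c.edges := (hG.edges_eq hc hd h1.ne
    (Walk.fst_mem_support_of_mem_edges _ hc1) (Walk.fst_mem_support_of_mem_edges _ hd1)
    (Walk.snd_mem_support_of_mem_edges _ hc1) (Walk.snd_mem_support_of_mem_edges _ hd1) _).2 hd3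
  have hn := hc.ncard_neighborSet_toSubgraph_eq_two (Walk.fst_mem_support_of_mem_edges _ hc1)
  have hsub : ({y1, y2, y3} : Set V) ⊆ c.toSubgraph.neighborSet x := by
    intro y hy
    simp only [Set.mem_insert_iff, Set.mem_singleton_iff] at hy
    rw [Subgraph.mem_neighborSet, ← Subgraph.mem_edgeSet, Walk.mem_edges_toSubgraph]
    rcases hy with rfl | rfl | rfl <;> assumption
  have hfin : (c.toSubgraph.neighborSet x).Finite := Set.finite_of_ncard_ne_zero (by omega)
  have := Set.ncard_le_ncard hsub hfin
  rw [Set.ncard_eq_three.2 ⟨y1, y2, y3, h12, h13, h23, rfl⟩] at this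
  omega

lemma Cac.mono {V : Type} {G K : SimpleGraph V} (hG : Cac G) (h : K ≤ G) : Cac K := by
  intro u w c1 c2 h1 h2 hne
  have := hG u w (c1.mapLe h) (c2.mapLe h) (h1.mapLe h) (h2.mapLe h)
  simpa using this (by simpa using hne)

lemma cyc_induce {V : Type} {H : SimpleGraph V} (X : Set V) {u : V} (c : H.Walk u u)
    (hc : c.IsCycle) (hX : ∀ x ∈ c.support, x ∈ X) :
    ∃ (x : X) (d : (H.induce X).Walk x x), d.IsCycle ∧ c.support = d.support.map Subtype.val ∧
      c.edges = d.edges.map (Sym2.map Subtype.val) := by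
  have h := Walk.map_induce c hX
  have hι : Function.Injective (Embedding.induce (G := H) X).toHom :=
    fun a b hab => Subtype.ext hab
  refine ⟨⟨u, hX u (by simp)⟩, c.induce X hX, ?_, ?_, ?_⟩
  · apply (Walk.isCycle_map_iff_of_injective hι).1
    exact Eq.mpr (congrArg Walk.IsCycle h) hc
  · exact (congrArg Walk.support h).symm.trans (Walk.support_map _ _)
  · exact (congrArg Walk.edges h).symm.trans (Walk.edges_map _ _)

/-- transfer of the cycle condition along a map that is injective on a region -/
lemma Cac.transfer {V : Type} {G H : SimpleGraph V} (hG : Cac G) (X : Set V) (φ : V → V)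
    (hinj : Set.InjOn φ X) (hadj : ∀ x ∈ X, ∀ y ∈ X, H.Adj x y → G.Adj (φ x) (φ y))
    {u w : V} (c1 : H.Walk u u) (c2 : H.Walk w w) (h1 : c1.IsCycle) (h2 : c2.IsCycle)
    (hX1 : ∀ x ∈ c1.support, x ∈ X) (hX2 : ∀ x ∈ c2.support, x ∈ X)
    (hne : c1.edges.toFinset ≠ c2.edges.toFinset) :
    (c1.support.toFinset ∩ c2.support.toFinset).card ≤ 1 := by
  let F : (H.induce X) →g G := ⟨fun x => φ x.1, fun {a b} hab => hadj _ a.2 _ b.2 hab⟩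
  have hF : Function.Injective F := fun a b hab => Subtype.ext (hinj a.2 b.2 hab)
  obtain ⟨x1, d1, i1, s1, m1⟩ := cyc_induce X c1 h1 hX1
  obtain ⟨x2, d2, i2, s2, m2⟩ := cyc_induce X c2 h2 hX2
  have j1 := (Walk.isCycle_map_iff_of_injective hF).2 i1
  have j2 := (Walk.isCycle_map_iff_of_injective hF).2 i2
  have key := hG _ _ _ _ j1 j2
  rw [Finset.card_le_one]
  intro a ha b hb
  simp only [Finset.mem_inter, List.mem_toFinset] at ha hb
  by_contra hab
  have hE : (d1.map F).edges.toFinset ≠ (d2.map F).edges.toFinset := by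
    intro he
    apply hne
    have : d1.edges.toFinset = d2.edges.toFinset := by
      rw [Walk.edges_map, Walk.edges_map] at he
      ext x
      have h3 : Sym2.map F x ∈ (d1.edges.map (Sym2.map F)).toFinset ↔
        Sym2.map F x ∈ (d2.edges.map (Sym2.map F)).toFinset := by rw [he]
      simp only [List.mem_toFinset,
        List.mem_map_of_injective (Sym2.map.injective hF)] at h3 ⊢
      exact h3
    rw [m1, m2]
    ext x
    simp only [List.mem_toFinset, List.mem_map]
    constructor
    · rintro ⟨y, hy, rfl⟩
      exact ⟨y, by rw [← List.mem_toFinset, ← this, List.mem_toFinset]; exact hy, rfl⟩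
    · rintro ⟨y, hy, rfl⟩
      exact ⟨y, by rw [← List.mem_toFinset, this, List.mem_toFinset]; exact hy, rfl⟩
  have key := key hE
  rw [Finset.card_le_one] at key
  have tr : ∀ a (haX : a ∈ X) (ha : a ∈ c1.support ∧ a ∈ c2.support),
      φ a ∈ (d1.map F).support.toFinset ∩ (d2.map F).support.toFinset := by
    intro a haX ha
    simp only [Finset.mem_inter, List.mem_toFinset, Walk.support_map, List.mem_map]
    have := ha.1
    have h' := ha.2
    rw [s1, List.mem_map] at this
    rw [s2, List.mem_map] at h'
    obtain ⟨x, hx, hxa⟩ := this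
    obtain ⟨y, hy, hya⟩ := h'
    have hxa' : x.1 = a := hxa
    have hya' : y.1 = a := hya
    exact ⟨⟨x, hx, by show φ x.1 = _; rw [hxa']⟩, ⟨y, hy, by show φ y.1 = _; rw [hya']⟩⟩
  have := key _ (tr a (hX1 _ ha.1) ha) _ (tr b (hX1 _ hb.1) hb)
  exact hab (hinj (hX1 _ ha.1) (hX1 _ hb.1) this)

end S16


namespace S16

/-- Surgery data: a core `K` of `G` with the projection `pr` of every vertex to its gate in the
core, a new core graph `K'` on `K`, and new attachment points `at_ p` for the branches at `p`. -/
structure Surg {V : Type} (G : SimpleGraph V) where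
  K : Set V
  pr : V → V
  at_ : V → V
  K' : SimpleGraph V
  pr_mem : ∀ x, pr x ∈ K
  pr_id : ∀ x ∈ K, pr x = x
  adj_out : ∀ x y, G.Adj x y → x ∉ K → pr x = pr y
  at_mem : ∀ x ∈ K, at_ x ∈ K
  K'_sub : ∀ x y, K'.Adj x y → x ∈ K
  K'_conn : ∀ x ∈ K, ∀ y ∈ K, K'.Reachable x y
  K'_cac : Cac K'

namespace Surg

variable {V : Type} {G : SimpleGraph V} (s : Surg G)

noncomputable def tau (x : V) : V := if x ∈ s.K then s.at_ x else x

lemma sum_split {V : Type} (H : SimpleGraph V) (A B : Finset (Sym2 V)) (h : Disjoint A B) :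
    ∑ e ∈ A ∪ B, ∑ f ∈ A ∪ B, eDist H e f = ∑ e ∈ A, ∑ f ∈ A, eDist H e f +
      2 * ∑ e ∈ B, ∑ f ∈ A, eDist H e f + ∑ e ∈ B, ∑ f ∈ B, eDist H e f := by
  rw [Finset.sum_union h]
  simp only [Finset.sum_union h, Finset.sum_add_distrib]
  have : ∑ e ∈ A, ∑ f ∈ B, eDist H e f = ∑ e ∈ B, ∑ f ∈ A, eDist H e f := by
    rw [Finset.sum_comm]
    simp only [eDist_comm]
  rw [this]
  ring

lemma tau_mem {x : V} (h : x ∈ s.K) : s.tau x = s.at_ x := if_pos h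
lemma tau_not {x : V} (h : x ∉ s.K) : s.tau x = x := if_neg h
lemma tau_mem_iff (x : V) : s.tau x ∈ s.K ↔ x ∈ s.K := by
  by_cases h : x ∈ s.K
  · rw [s.tau_mem h]; simp [h, s.at_mem x h]
  · rw [s.tau_not h]

lemma tau_ne {a b : V} (h : G.Adj a b) (ha : a ∉ s.K) : s.tau a ≠ s.tau b := by
  intro e
  by_cases hb : b ∈ s.K
  · exact ha ((s.tau_mem_iff a).1 (e ▸ (s.tau_mem_iff b).2 hb))
  · rw [s.tau_not ha, s.tau_not hb] at e
    exact h.ne e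

/-- the new graph -/
def H : SimpleGraph V where
  Adj x y := s.K'.Adj x y ∨ ∃ a b, G.Adj a b ∧ a ∉ s.K ∧
    ((x = s.tau a ∧ y = s.tau b) ∨ (x = s.tau b ∧ y = s.tau a))
  symm := ⟨by
    rintro x y (h | ⟨a, b, h, ha, h'⟩)
    · exact Or.inl h.symm
    · exact Or.inr ⟨a, b, h, ha, by tauto⟩⟩
  loopless := ⟨by
    rintro x (h | ⟨a, b, h, ha, ⟨h1, h2⟩ | ⟨h1, h2⟩⟩)
    · exact h.ne rfl
    · exact s.tau_ne h ha (h1.symm.trans h2)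
    · exact s.tau_ne h ha (h2.symm.trans h1)⟩

lemma H_adj_tau {a b : V} (h : G.Adj a b) (ha : a ∉ s.K) : s.H.Adj (s.tau a) (s.tau b) :=
  Or.inr ⟨a, b, h, ha, Or.inl ⟨rfl, rfl⟩⟩

lemma H_adj_core {x y : V} (h : s.H.Adj x y) (hx : x ∈ s.K) (hy : y ∈ s.K) : s.K'.Adj x y := by
  rcases h with h | ⟨a, b, h, ha, ⟨h1, h2⟩ | ⟨h1, h2⟩⟩
  · exact h
  · exact absurd ((s.tau_mem_iff a).1 (h1 ▸ hx)) ha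
  · exact absurd ((s.tau_mem_iff a).1 (h2 ▸ hy)) ha

lemma H_adj_out {x y : V} (h : s.H.Adj x y) (hx : x ∉ s.K) : ∃ b, G.Adj x b ∧ y = s.tau b := by
  rcases h with h | ⟨a, b, h, ha, ⟨h1, h2⟩ | ⟨h1, h2⟩⟩
  · exact absurd (s.K'_sub _ _ h) hx
  · rw [s.tau_not ha] at h1
    subst h1
    exact ⟨b, h, h2⟩
  · have hb : b ∉ s.K := fun hb => hx (h1 ▸ (s.tau_mem_iff b).2 hb)
    rw [s.tau_not hb] at h1
    subst h1
    exact ⟨a, h.symm, h2⟩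

/-- the branches at `p` -/
def S (p : V) : Set V := {y | y ∉ s.K ∧ s.pr y = p}

lemma closed_H {p : V} (hp : p ∈ s.K) : Closed s.H (s.S p) (s.at_ p) := by
  refine ⟨fun h => h.1 (s.at_mem p hp), fun x y hxy hx hy => ?_⟩
  obtain ⟨b, hb, rfl⟩ := s.H_adj_out hxy hx.1
  have h1 := s.adj_out _ _ hb hx.1
  by_cases hbK : b ∈ s.K
  · rw [s.tau_mem hbK]
    rw [s.pr_id b hbK, hx.2] at h1
    rw [h1]
  · rw [s.tau_not hbK] at hy ⊢
    exact absurd ⟨hbK, h1 ▸ hx.2⟩ hy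

lemma closed_G {p : V} (hp : p ∈ s.K) : Closed G (s.S p) p := by
  refine ⟨fun h => h.1 hp, fun x y hxy hx hy => ?_⟩
  have h1 := s.adj_out _ _ hxy hx.1
  by_cases hbK : y ∈ s.K
  · rw [s.pr_id y hbK, hx.2] at h1
    exact h1.symm
  · exact absurd ⟨hbK, h1 ▸ hx.2⟩ hy

lemma reach_tau (hG : G.Connected) (x : V) : s.H.Reachable (s.tau x) (s.at_ (s.pr x)) := by
  have key : ∀ {x y : V} (_ : G.Walk x y), y ∈ s.K → s.H.Reachable (s.tau x) (s.at_ (s.pr x)) := by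
    intro x y p
    induction p with
    | nil =>
      intro h
      rw [s.tau_mem h, s.pr_id _ h]
    | @cons a b c hab p ih =>
      intro h
      by_cases ha : a ∈ s.K
      · rw [s.tau_mem ha, s.pr_id _ ha]
      · rw [s.adj_out _ _ hab ha]
        exact (s.H_adj_tau hab ha).reachable.trans (ih h)
  obtain ⟨p⟩ := hG x (s.pr x)
  exact key p (s.pr_mem x)

lemma conn (hG : G.Connected) : s.H.Connected := by
  have hK : ∀ x ∈ s.K, ∀ y ∈ s.K, s.H.Reachable x y := fun x hx y hy =>
    (s.K'_conn x hx y hy).mono (fun a b h => Or.inl h)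
  have h1 : ∀ x, ∃ y ∈ s.K, s.H.Reachable x y := by
    intro x
    by_cases hx : x ∈ s.K
    · exact ⟨x, hx, Reachable.refl x⟩
    · have := s.reach_tau hG x
      rw [s.tau_not hx] at this
      exact ⟨_, s.at_mem _ (s.pr_mem x), this⟩
  haveI := hG.nonempty
  refine ⟨fun x y => ?_⟩
  obtain ⟨a, ha, hxa⟩ := h1 x
  obtain ⟨b, hb, hyb⟩ := h1 y
  exact hxa.trans ((hK a ha b hb).trans hyb.symm)

/-- retraction to the branches at `p` -/
noncomputable def phi (p : V) (y : V) : V := if y ∈ s.S p then y else p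

lemma phi_adj {p : V} (hp : p ∈ s.K) {x y : V} (h : s.H.Adj x y) (hx : x ∈ s.S p) :
    G.Adj (s.phi p x) (s.phi p y) := by
  obtain ⟨b, hb, rfl⟩ := s.H_adj_out h hx.1
  have h1 := s.adj_out _ _ hb hx.1
  unfold phi
  rw [if_pos hx]
  by_cases hbK : b ∈ s.K
  · rw [if_neg (fun h' => h'.1 ((s.tau_mem_iff b).2 hbK))]
    rw [s.pr_id b hbK, hx.2] at h1
    rwa [h1]
  · rw [s.tau_not hbK, if_pos ⟨hbK, h1 ▸ hx.2⟩]
    exact hb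

lemma phi_weak {p : V} (hp : p ∈ s.K) (x y : V) (h : s.H.Adj x y) :
    s.phi p x = s.phi p y ∨ G.Adj (s.phi p x) (s.phi p y) := by
  by_cases hx : x ∈ s.S p
  · exact Or.inr (s.phi_adj hp h hx)
  · by_cases hy : y ∈ s.S p
    · exact Or.inr (s.phi_adj hp h.symm hy).symm
    · left; simp [phi, hx, hy]

lemma phi_tau {x : V} : s.phi (s.pr x) (s.tau x) = x := by
  unfold phi
  by_cases hx : x ∈ s.K
  · rw [if_neg (fun h' => h'.1 ((s.tau_mem_iff x).2 hx)), s.pr_id x hx]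
  · rw [s.tau_not hx, if_pos ⟨hx, rfl⟩]

lemma dist_same (hG : G.Connected) {x y : V} (h : s.pr x = s.pr y) :
    G.dist x y ≤ s.H.dist (s.tau x) (s.tau y) := by
  have h1 := weak_dist (s.phi (s.pr x)) (s.phi_weak (s.pr_mem x)) (s.conn hG (s.tau x) (s.tau y))
  rw [s.phi_tau] at h1
  rw [h, s.phi_tau] at h1
  exact h1

lemma dist_gate (hG : G.Connected) (x : V) :
    G.dist x (s.pr x) ≤ s.H.dist (s.tau x) (s.at_ (s.pr x)) := by
  have := s.dist_same hG (x := x) (y := s.pr x) (by rw [s.pr_id _ (s.pr_mem x)])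
  rwa [s.tau_mem (s.pr_mem x)] at this

lemma dist_out (hG : G.Connected) (x : V) {y : V} (hy : y ∉ s.S (s.pr x)) :
    G.dist x (s.pr x) + s.H.dist (s.at_ (s.pr x)) y ≤ s.H.dist (s.tau x) y := by
  by_cases hx : x ∈ s.K
  · rw [s.pr_id x hx, s.tau_mem hx]; simp
  · have h1 := (s.closed_H (s.pr_mem x)).dist (s.conn hG) (x := s.tau x) (y := y)
      (by rw [s.tau_not hx]; exact ⟨hx, rfl⟩) hy
    have := s.dist_gate hG x
    omega

lemma dist_diff (hG : G.Connected) {x y : V} (h : s.pr x ≠ s.pr y) :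
    G.dist x (s.pr x) + s.H.dist (s.at_ (s.pr x)) (s.at_ (s.pr y)) + G.dist y (s.pr y)
      ≤ s.H.dist (s.tau x) (s.tau y) := by
  have h1 := s.dist_out hG x (y := s.tau y) (by
    rintro ⟨h1, h2⟩
    rw [s.tau_mem_iff] at h1
    rw [s.tau_not h1] at h2
    exact h h2.symm)
  have h2 := s.dist_out hG y (y := s.at_ (s.pr x)) (fun h => h.1 (s.at_mem _ (s.pr_mem x)))
  have e1 := dist_comm (G := s.H) (u := s.at_ (s.pr x)) (v := s.at_ (s.pr y))
  have e2 := dist_comm (G := s.H) (u := s.tau y) (v := s.at_ (s.pr x))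
  omega

lemma cac (hG : Cac G) : Cac s.H := by
  intro u w c1 c2 h1 h2 hne
  by_cases hK1 : ∀ x ∈ c1.support, x ∈ s.K
  · by_cases hK2 : ∀ x ∈ c2.support, x ∈ s.K
    · exact s.K'_cac.transfer s.K id (fun a _ b _ h => h)
        (fun x hx y hy h => s.H_adj_core h hx hy) c1 c2 h1 h2 hK1 hK2 hne
    · push Not at hK2
      obtain ⟨y, hy, hyK⟩ := hK2
      rw [Finset.card_le_one]
      have : ∀ a ∈ c1.support.toFinset ∩ c2.support.toFinset, a = s.at_ (s.pr y) := by
        intro a ha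
        simp only [Finset.mem_inter, List.mem_toFinset] at ha
        rcases (s.closed_H (s.pr_mem y)).cycle c2 h2 hy ⟨hyK, rfl⟩ ha.2 with h | h
        · exact absurd (hK1 a ha.1) h.1
        · exact h
      intro a ha b hb
      rw [this a ha, this b hb]
  · push Not at hK1
    obtain ⟨x, hx, hxK⟩ := hK1
    have hc1 : ∀ a ∈ c1.support, a ∈ s.S (s.pr x) ∨ a = s.at_ (s.pr x) := fun a ha =>
      (s.closed_H (s.pr_mem x)).cycle c1 h1 hx ⟨hxK, rfl⟩ ha
    by_cases hm : ∃ y ∈ c2.support, y ∈ s.S (s.pr x)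
    · obtain ⟨y, hy, hyS⟩ := hm
      have hc2 : ∀ a ∈ c2.support, a ∈ s.S (s.pr x) ∨ a = s.at_ (s.pr x) := fun a ha =>
        (s.closed_H (s.pr_mem x)).cycle c2 h2 hy hyS ha
      have hat : s.at_ (s.pr x) ∉ s.S (s.pr x) := fun h => h.1 (s.at_mem _ (s.pr_mem x))
      have hpr : s.pr x ∉ s.S (s.pr x) := fun h => h.1 (s.pr_mem x)
      refine hG.transfer {a | a ∈ s.S (s.pr x) ∨ a = s.at_ (s.pr x)} (s.phi (s.pr x)) ?_ ?_
        c1 c2 h1 h2 hc1 hc2 hne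
      · rintro a (ha | rfl) b (hb | rfl) hab
        · simpa [phi, ha, hb] using hab
        · simp only [phi, if_pos ha, if_neg hat] at hab
          exact absurd (hab ▸ ha) hpr
        · simp only [phi, if_pos hb, if_neg hat] at hab
          exact absurd (hab ▸ hb) hpr
        · rfl
      · rintro a (ha | rfl) b (hb | rfl) hab
        · exact s.phi_adj (s.pr_mem x) hab ha
        · exact s.phi_adj (s.pr_mem x) hab ha
        · exact (s.phi_adj (s.pr_mem x) hab.symm hb).symm
        · exact absurd rfl hab.ne
    · push Not at hm
      rw [Finset.card_le_one]
      have : ∀ a ∈ c1.support.toFinset ∩ c2.support.toFinset, a = s.at_ (s.pr x) := by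
        intro a ha
        simp only [Finset.mem_inter, List.mem_toFinset] at ha
        exact (hc1 a ha.1).resolve_left (hm a ha.2)
      intro a ha b hb
      rw [this a ha, this b hb]

lemma isCactus (hG : IsCactus G) : IsCactus s.H := ⟨s.conn hG.1, s.cac hG.2⟩

/-! edges -/

variable [Fintype V]

/-- edges of `G` that are not in the core -/
noncomputable def N : Finset (Sym2 V) := G.edgeFinset.filter (fun e => ¬ ∀ x ∈ e, x ∈ s.K)
/-- edges of `G` in the core -/
noncomputable def C : Finset (Sym2 V) := G.edgeFinset.filter (fun e => ∀ x ∈ e, x ∈ s.K)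

noncomputable def psi (e : Sym2 V) : Sym2 V := e.map s.tau
/-- the root of an edge outside the core -/
noncomputable def rt (e : Sym2 V) : V := s.pr (Quot.out e).1
noncomputable def ht (e : Sym2 V) : ℕ := vDist G (s.rt e) e

lemma mem_N {e : Sym2 V} (he : e ∈ s.N) : ∃ a b, e = s(a, b) ∧ G.Adj a b ∧ a ∉ s.K := by
  induction e using Sym2.ind with
  | _ x y =>
    simp only [N, Finset.mem_filter, mem_edgeFinset, mem_edgeSet] at he
    obtain ⟨h1, h2⟩ := he
    by_cases hx : x ∈ s.K
    · refine ⟨y, x, Sym2.eq_swap, h1.symm, fun hy => h2 ?_⟩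
      intro z hz
      rcases Sym2.mem_iff.1 hz with rfl | rfl <;> assumption
    · exact ⟨x, y, rfl, h1, hx⟩

lemma pr_rt {e : Sym2 V} (he : e ∈ s.N) {a : V} (ha : a ∈ e) : s.pr a = s.rt e := by
  obtain ⟨x, y, rfl, hxy, hx⟩ := s.mem_N he
  have h0 := s.adj_out _ _ hxy hx
  have : ∀ z ∈ s(x, y), s.pr z = s.pr x := by
    intro z hz
    rcases Sym2.mem_iff.1 hz with rfl | rfl
    · rfl
    · exact h0.symm
  rw [this a ha]
  unfold rt
  rw [this _ (Sym2.out_fst_mem _)]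

lemma rt_mem (e : Sym2 V) : s.rt e ∈ s.K := s.pr_mem _

lemma ht_le {e : Sym2 V} {a : V} (ha : a ∈ e) : s.ht e ≤ G.dist a (s.rt e) := by
  rw [dist_comm]; exact vDist_le G ha

lemma psi_out {e : Sym2 V} (he : e ∈ s.N) : ∃ x ∈ s.psi e, x ∉ s.K := by
  obtain ⟨x, y, rfl, hxy, hx⟩ := s.mem_N he
  exact ⟨x, by simp [psi, s.tau_not hx], hx⟩

lemma K'_in {e : Sym2 V} (he : e ∈ s.K'.edgeFinset) {x : V} (hx : x ∈ e) : x ∈ s.K := by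
  induction e using Sym2.ind with
  | _ a b =>
    rw [mem_edgeFinset, mem_edgeSet] at he
    rcases Sym2.mem_iff.1 hx with rfl | rfl
    · exact s.K'_sub _ _ he
    · exact s.K'_sub _ _ he.symm

lemma psi_inj : Set.InjOn s.psi s.N := by
  intro e he f hf hef
  obtain ⟨a, b, rfl, hab, ha⟩ := s.mem_N he
  obtain ⟨c, d, rfl, hcd, hc⟩ := s.mem_N hf
  simp only [psi, Sym2.map_mk] at hef
  have key : ∀ a b c d, G.Adj a b → a ∉ s.K → G.Adj c d → c ∉ s.K → s.tau a = s.tau c →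
      s.tau b = s.tau d → a = c ∧ b = d := by
    intro a b c d hab ha hcd hc h1 h2
    rw [s.tau_not ha, s.tau_not hc] at h1
    subst h1
    refine ⟨rfl, ?_⟩
    by_cases hb : b ∈ s.K
    · have hd : d ∈ s.K := (s.tau_mem_iff d).1 (h2 ▸ (s.tau_mem_iff b).2 hb)
      have e1 := s.adj_out _ _ hab ha
      have e2 := s.adj_out _ _ hcd ha
      rw [s.pr_id b hb] at e1
      rw [s.pr_id d hd] at e2
      exact e1.symm.trans e2
    · have hd : d ∉ s.K := fun hd => hb ((s.tau_mem_iff b).1 (h2 ▸ (s.tau_mem_iff d).2 hd))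
      rwa [s.tau_not hb, s.tau_not hd] at h2
  rcases Sym2.eq_iff.1 hef with ⟨h1, h2⟩ | ⟨h1, h2⟩
  · obtain ⟨rfl, rfl⟩ := key a b c d hab ha hcd hc h1 h2
    rfl
  · have hd : d ∉ s.K := fun hd => ha ((s.tau_mem_iff a).1 (h1 ▸ (s.tau_mem_iff d).2 hd))
    obtain ⟨rfl, rfl⟩ := key a b d c hab ha hcd.symm hd h1 h2
    exact Sym2.eq_swap

lemma H_edges : s.H.edgeFinset = s.K'.edgeFinset ∪ s.N.image s.psi := by
  ext e
  induction e using Sym2.ind with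
  | _ x y =>
    simp only [mem_edgeFinset, mem_edgeSet, Finset.mem_union, Finset.mem_image]
    constructor
    · rintro (h | ⟨a, b, h, ha, h'⟩)
      · exact Or.inl h
      · refine Or.inr ⟨s(a, b), ?_, ?_⟩
        · simp only [N, Finset.mem_filter, mem_edgeFinset, mem_edgeSet]
          exact ⟨h, fun h2 => ha (h2 a (by simp))⟩
        · simp only [psi, Sym2.map_mk]
          rcases h' with ⟨rfl, rfl⟩ | ⟨rfl, rfl⟩
          · rfl
          · exact Sym2.eq_swap
    · rintro (h | ⟨e, he, h⟩)
      · exact Or.inl h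
      · obtain ⟨a, b, rfl, hab, ha⟩ := s.mem_N he
        have := s.H_adj_tau hab ha
        rw [← mem_edgeSet] at this ⊢
        rwa [← h]

lemma H_disj : Disjoint s.K'.edgeFinset (s.N.image s.psi) := by
  rw [Finset.disjoint_left]
  intro e h1 h2
  obtain ⟨f, hf, rfl⟩ := Finset.mem_image.1 h2
  obtain ⟨x, hx, hxK⟩ := s.psi_out hf
  exact hxK (s.K'_in h1 hx)

lemma G_edges : G.edgeFinset = s.C ∪ s.N := (Finset.filter_union_filter_not_eq _ _).symm
lemma G_disj : Disjoint s.C s.N := Finset.disjoint_filter_filter_not _ _ _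

lemma card_H : s.H.edgeFinset.card = s.K'.edgeFinset.card + s.N.card := by
  rw [s.H_edges, Finset.card_union_of_disjoint s.H_disj, Finset.card_image_of_injOn s.psi_inj]

lemma card_G : G.edgeFinset.card = s.C.card + s.N.card := by
  conv_lhs => rw [s.G_edges]
  rw [Finset.card_union_of_disjoint s.G_disj]

lemma card_eq (h : s.K'.edgeFinset.card = s.C.card) :
    s.H.edgeFinset.card = G.edgeFinset.card := by
  rw [s.card_H, s.card_G, h]

/-- twice the edge-Wiener index -/
noncomputable def W2 (G : SimpleGraph V) : ℕ :=
  ∑ e ∈ G.edgeFinset, ∑ f ∈ G.edgeFinset, eDist G e f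

lemma W2_G : W2 G = ∑ e ∈ s.C, ∑ f ∈ s.C, eDist G e f +
      2 * ∑ e ∈ s.N, ∑ f ∈ s.C, eDist G e f + ∑ e ∈ s.N, ∑ f ∈ s.N, eDist G e f := by
  unfold W2
  conv_lhs => rw [s.G_edges]
  exact sum_split _ _ _ s.G_disj

lemma W2_H : W2 s.H = ∑ e ∈ s.K'.edgeFinset, ∑ f ∈ s.K'.edgeFinset, eDist s.H e f +
      2 * ∑ e ∈ s.N, ∑ f ∈ s.K'.edgeFinset, eDist s.H (s.psi e) f +
      ∑ e ∈ s.N, ∑ f ∈ s.N, eDist s.H (s.psi e) (s.psi f) := by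
  unfold W2
  rw [s.H_edges, sum_split _ _ _ s.H_disj]
  simp only [Finset.sum_image s.psi_inj]

lemma bd_HK (hG : G.Connected) {e f : Sym2 V} (he : e ∈ s.N) (hf : f ∈ s.K'.edgeFinset) :
    s.ht e + vDist s.H (s.at_ (s.rt e)) f + 1 ≤ eDist s.H (s.psi e) f := by
  apply le_eDist
  · rintro rfl
    obtain ⟨x, hx, hxK⟩ := s.psi_out he
    exact hxK (s.K'_in hf hx)
  · intro u hu w hw
    obtain ⟨a, ha, rfl⟩ := Sym2.mem_map.1 hu
    have h1 := s.dist_out hG a (y := w) (fun h => h.1 (s.K'_in hf hw))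
    rw [s.pr_rt he ha] at h1
    have h2 := s.ht_le ha
    have h3 := vDist_le s.H (v := s.at_ (s.rt e)) hw
    omega

lemma ht_exists (e : Sym2 V) : ∃ a ∈ e, s.ht e = G.dist (s.rt e) a := vDist_exists _ _ _

lemma bd_GK (hG : G.Connected) (e f : Sym2 V) :
    eDist G e f ≤ s.ht e + vDist G (s.rt e) f + 1 := by
  obtain ⟨a, ha, h1⟩ := s.ht_exists e
  obtain ⟨w, hw, h2⟩ := vDist_exists G (s.rt e) f
  refine (eDist_le G ha hw).trans ?_
  rw [h1, h2, dist_comm (u := s.rt e)]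
  exact Nat.add_le_add_right hG.dist_triangle 1

lemma bd_NN (hG : G.Connected) {e f : Sym2 V} (he : e ∈ s.N) (hf : f ∈ s.N) :
    eDist G e f + s.H.dist (s.at_ (s.rt e)) (s.at_ (s.rt f)) ≤
      eDist s.H (s.psi e) (s.psi f) + G.dist (s.rt e) (s.rt f) := by
  by_cases hef : e = f
  · subst hef; simp [eDist_self]
  have hne : s.psi e ≠ s.psi f := fun h => hef (s.psi_inj he hf h)
  by_cases hr : s.rt e = s.rt f
  · rw [hr]
    simp only [dist_self, add_zero]
    obtain ⟨u, hu, w, hw, h⟩ := eDist_exists s.H hne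
    obtain ⟨a, ha, rfl⟩ := Sym2.mem_map.1 hu
    obtain ⟨b, hb, rfl⟩ := Sym2.mem_map.1 hw
    rw [h]
    refine (eDist_le G ha hb).trans (Nat.add_le_add_right (s.dist_same hG ?_) 1)
    rw [s.pr_rt he ha, s.pr_rt hf hb, hr]
  · have h1 : s.ht e + s.ht f + s.H.dist (s.at_ (s.rt e)) (s.at_ (s.rt f)) + 1 ≤
        eDist s.H (s.psi e) (s.psi f) := by
      apply le_eDist _ hne
      intro u hu w hw
      obtain ⟨a, ha, rfl⟩ := Sym2.mem_map.1 hu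
      obtain ⟨b, hb, rfl⟩ := Sym2.mem_map.1 hw
      have := s.dist_diff hG (x := a) (y := b) (by rwa [s.pr_rt he ha, s.pr_rt hf hb])
      rw [s.pr_rt he ha, s.pr_rt hf hb] at this
      have h2 := s.ht_le ha
      have h3 := s.ht_le hb
      omega
    obtain ⟨a, ha, h2⟩ := s.ht_exists e
    obtain ⟨b, hb, h3⟩ := s.ht_exists f
    have h4 := eDist_le G ha hb
    have h5 : G.dist a b ≤ G.dist a (s.rt e) + G.dist (s.rt e) b := hG.dist_triangle
    have h6 : G.dist (s.rt e) b ≤ G.dist (s.rt e) (s.rt f) + G.dist (s.rt f) b := hG.dist_triangle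
    have h7 : G.dist a (s.rt e) = G.dist (s.rt e) a := dist_comm
    omega

/-- the main estimate -/
theorem main (hG : G.Connected) (hc : s.K'.edgeFinset.card = s.C.card) :
    W2 G + ∑ e ∈ s.K'.edgeFinset, ∑ f ∈ s.K'.edgeFinset, eDist s.H e f +
      2 * ∑ e ∈ s.N, ∑ f ∈ s.K'.edgeFinset, vDist s.H (s.at_ (s.rt e)) f +
      ∑ e ∈ s.N, ∑ f ∈ s.N, s.H.dist (s.at_ (s.rt e)) (s.at_ (s.rt f)) ≤
    W2 s.H + ∑ e ∈ s.C, ∑ f ∈ s.C, eDist G e f + 2 * ∑ e ∈ s.N, ∑ f ∈ s.C, vDist G (s.rt e) f +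
      ∑ e ∈ s.N, ∑ f ∈ s.N, G.dist (s.rt e) (s.rt f) := by
  rw [s.W2_G, s.W2_H]
  have h1 : ∑ e ∈ s.N, ∑ f ∈ s.N, eDist G e f +
      ∑ e ∈ s.N, ∑ f ∈ s.N, s.H.dist (s.at_ (s.rt e)) (s.at_ (s.rt f)) ≤
      ∑ e ∈ s.N, ∑ f ∈ s.N, eDist s.H (s.psi e) (s.psi f) +
      ∑ e ∈ s.N, ∑ f ∈ s.N, G.dist (s.rt e) (s.rt f) := by
    simp only [← Finset.sum_add_distrib]
    exact Finset.sum_le_sum fun e he => Finset.sum_le_sum fun f hf => s.bd_NN hG he hf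
  have h2 : ∑ e ∈ s.N, ∑ f ∈ s.C, eDist G e f +
      ∑ e ∈ s.N, ∑ f ∈ s.K'.edgeFinset, vDist s.H (s.at_ (s.rt e)) f ≤
      ∑ e ∈ s.N, ∑ f ∈ s.K'.edgeFinset, eDist s.H (s.psi e) f +
      ∑ e ∈ s.N, ∑ f ∈ s.C, vDist G (s.rt e) f := by
    simp only [← Finset.sum_add_distrib]
    refine Finset.sum_le_sum fun e he => ?_
    have a1 : ∑ f ∈ s.C, eDist G e f ≤ ∑ f ∈ s.C, (vDist G (s.rt e) f + (s.ht e + 1)) :=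
      Finset.sum_le_sum fun f _ => by have := s.bd_GK hG e f; omega
    have a2 : ∑ f ∈ s.K'.edgeFinset, (vDist s.H (s.at_ (s.rt e)) f + (s.ht e + 1)) ≤
        ∑ f ∈ s.K'.edgeFinset, eDist s.H (s.psi e) f :=
      Finset.sum_le_sum fun f hf => by have := s.bd_HK hG he hf; omega
    rw [Finset.sum_add_distrib, Finset.sum_const, smul_eq_mul] at a1 a2
    rw [hc] at a2
    omega
  omega

end Surg

end S16


namespace S16

/-- optimality among cacti on the same vertex set with the same number of edges -/
def Opt {V : Type} [Fintype V] (G : SimpleGraph V) : Prop :=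
  IsCactus G ∧ ∀ H : SimpleGraph V, IsCactus H → H.edgeFinset.card = G.edgeFinset.card →
    Surg.W2 H < Surg.W2 G + 2

/-- surgery moving the branch `A` from `v` to `z` -/
noncomputable def moveSurg {V : Type} {G : SimpleGraph V} (hG : IsCactus G) {A : Set V} {v z : V}
    (hA : Closed G A v) (hz : z ∉ A) : Surg G where
  K := Aᶜ
  pr x := if x ∈ A then v else x
  at_ x := if x = v then z else x
  K' := 
    { Adj := fun x y => G.Adj x y ∧ x ∉ A ∧ y ∉ A
      symm := ⟨fun x y h => ⟨h.1.symm, h.2.2, h.2.1⟩⟩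
      loopless := ⟨fun x h => h.1.ne rfl⟩ }
  pr_mem x := by
    split_ifs with h
    · exact hA.1
    · exact h
  pr_id x hx := if_neg hx
  adj_out x y h hx := by
    have hx : x ∈ A := by simpa using hx
    rw [if_pos hx]
    split_ifs with hy
    · rfl
    · exact (hA.2 x y h hx hy).symm
  at_mem x hx := by
    split_ifs with h
    · exact hz
    · exact hx
  K'_sub x y h := h.2.1
  K'_conn x hx y hy := by
    have := weak_reach (G := G) (G' := 
      { Adj := fun x y => G.Adj x y ∧ x ∉ A ∧ y ∉ A
        symm := ⟨fun x y h => ⟨h.1.symm, h.2.2, h.2.1⟩⟩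
        loopless := ⟨fun x h => h.1.ne rfl⟩ }) (fun x => if x ∈ A then v else x) (by
      intro x y h
      by_cases hx : x ∈ A <;> by_cases hy : y ∈ A
      · simp [hx, hy]
      · simp [hx, hy, hA.2 x y h hx hy]
      · simp [hx, hy, hA.2 y x h.symm hy hx]
      · simp [hx, hy, h]) (hG.1 x y)
    simpa [show x ∉ A from hx, show y ∉ A from hy] using this
  K'_cac := Cac.mono (G := G) hG.2 (by intro x y h; exact h.1)

theorem Opt.move {V : Type} [Fintype V] {G : SimpleGraph V} (hG : Opt G) {A : Set V} {v z : V}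
    (hA : Closed G A v) (hne : A.Nonempty) (hz : z ∉ A) :
    ∑ f ∈ G.edgeFinset.filter (fun f => ∀ x ∈ f, x ∉ A), vDist G z f ≤
      ∑ f ∈ G.edgeFinset.filter (fun f => ∀ x ∈ f, x ∉ A), vDist G v f := by
  by_contra hlt
  push Not at hlt
  set s := moveSurg hG.1 hA hz with hs
  have hC : s.C = G.edgeFinset.filter (fun f => ∀ x ∈ f, x ∉ A) := by
    ext e; simp only [Surg.C, Finset.mem_filter]; exact Iff.rfl
  rw [← hC] at hlt
  have hK : ∀ x, x ∈ s.K ↔ x ∉ A := fun x => Iff.rfl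
  have hat : s.at_ v = z := if_pos rfl
  have hKC : s.K'.edgeFinset = s.C := by
    ext e
    induction e using Sym2.ind with
    | _ x y =>
      rw [hC]
      simp only [mem_edgeFinset, mem_edgeSet, Finset.mem_filter, Sym2.mem_iff, forall_eq_or_imp,
        forall_eq]
      exact Iff.rfl
  have hcard : s.K'.edgeFinset.card = s.C.card := by rw [hKC]
  have hconn := s.conn hG.1.1
  have hrho : ∀ x y, s.H.Adj x y → (if x ∈ A then z else x) = (if y ∈ A then z else y) ∨
      G.Adj (if x ∈ A then z else x) (if y ∈ A then z else y) := by
    have key : ∀ x y, s.H.Adj x y → x ∈ A → y ∉ A → y = z := by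
      intro x y h hx hy
      obtain ⟨b, hb, rfl⟩ := s.H_adj_out h (by rw [hK]; simpa using hx)
      have hbA : b ∉ A := by
        rw [← hK] at hy ⊢; exact (s.tau_mem_iff b).1 hy
      have := hA.2 x b hb hx hbA
      subst this
      rw [s.tau_mem ((hK _).2 hbA), hat]
    intro x y h
    by_cases hx : x ∈ A <;> by_cases hy : y ∈ A
    · simp [hx, hy]
    · simp [hx, hy, key x y h hx hy]
    · simp [hx, hy, key y x h.symm hy hx]
    · have := (s.H_adj_core h ((hK _).2 hx) ((hK _).2 hy)).1
      simp [hx, hy, this]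
  have hdist : ∀ x y, x ∉ A → y ∉ A → G.dist x y ≤ s.H.dist x y := by
    intro x y hx hy
    have := weak_dist (G := s.H) (G' := G) (fun x => if x ∈ A then z else x) hrho (hconn x y)
    simpa [hx, hy] using this
  have hCin : ∀ e ∈ s.C, ∀ x ∈ e, x ∉ A := fun e he => (Finset.mem_filter.1 (hC ▸ he)).2
  have h1 : ∑ e ∈ s.C, ∑ f ∈ s.C, eDist G e f ≤ ∑ e ∈ s.C, ∑ f ∈ s.C, eDist s.H e f := by
    refine Finset.sum_le_sum fun e he => Finset.sum_le_sum fun f hf => ?_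
    by_cases hef : e = f
    · rw [hef, eDist_self]; omega
    · obtain ⟨u, hu, w, hw, h⟩ := eDist_exists s.H hef
      rw [h]
      exact (eDist_le G hu hw).trans
        (Nat.add_le_add_right (hdist u w (hCin e he u hu) (hCin f hf w hw)) 1)
  have hrt : ∀ e ∈ s.N, s.rt e = v := by
    intro e he
    obtain ⟨a, b, rfl, hab, ha⟩ := s.mem_N he
    rw [← s.pr_rt he (Sym2.mem_mk_left a b)]
    exact if_pos (by rw [hK] at ha; simpa using ha)
  have h2 : ∑ f ∈ s.C, vDist G z f ≤ ∑ f ∈ s.C, vDist s.H z f := by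
    refine Finset.sum_le_sum fun f hf => ?_
    obtain ⟨w, hw, h⟩ := vDist_exists s.H z f
    rw [h]
    exact (vDist_le G hw).trans (hdist z w hz (hCin f hf w hw))
  have h3 : ∑ e ∈ s.N, ∑ f ∈ s.N, G.dist (s.rt e) (s.rt f) = 0 := by
    refine Finset.sum_eq_zero fun e he => Finset.sum_eq_zero fun f hf => ?_
    rw [hrt e he, hrt f hf, dist_self]
  have hNpos : 1 ≤ s.N.card := by
    obtain ⟨x, hx, hxv⟩ := hA.exists_adj hG.1.1 hne
    refine Finset.card_pos.2 ⟨s(x, v), ?_⟩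
    refine Finset.mem_filter.2 ⟨by simpa using hxv, ?_⟩
    intro h
    exact (hK x).1 (h x (by simp)) hx
  have hmain := s.main hG.1.1 hcard
  rw [hKC, h3, Finset.sum_congr rfl (fun e he => by rw [hrt e he, hat] :
    ∀ e ∈ s.N, ∑ f ∈ s.C, vDist s.H (s.at_ (s.rt e)) f = ∑ f ∈ s.C, vDist s.H z f),
    Finset.sum_congr rfl (fun e he => by rw [hrt e he] :
    ∀ e ∈ s.N, ∑ f ∈ s.C, vDist G (s.rt e) f = ∑ f ∈ s.C, vDist G v f)] at hmain
  simp only [Finset.sum_const, smul_eq_mul] at hmain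
  have h4 := hG.2 s.H (s.isCactus hG.1) (s.card_eq hcard)
  have h5 : s.N.card * (∑ f ∈ s.C, vDist G v f + 1) ≤ s.N.card * ∑ f ∈ s.C, vDist s.H z f :=
    Nat.mul_le_mul_left _ (by omega)
  rw [Nat.mul_add] at h5
  omega

end S16


namespace S16

lemma sum_ind {α : Type} (F S : Finset α) (h : S ⊆ F) (k : ℕ)
    [inst : ∀ f, Decidable (f ∈ S)] :
    ∑ f ∈ F, (if f ∈ S then k else 0) = k * S.card := by
  rw [← Finset.sum_filter]
  have : F.filter (fun f => f ∈ S) = S := by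
    ext f; simp only [Finset.mem_filter]; exact ⟨fun h => h.2, fun h' => ⟨h h', h'⟩⟩
  rw [this]
  simp [mul_comm]

/-- the edges meeting `B` -/
noncomputable def EM {V : Type} [Fintype V] (G : SimpleGraph V) (B : Set V) : Finset (Sym2 V) :=
  G.edgeFinset.filter (fun f => ∃ x ∈ f, x ∈ B)

lemma mem_EM {V : Type} [Fintype V] {G : SimpleGraph V} {B : Set V} {f : Sym2 V}
    (hf : f ∈ G.edgeFinset) : f ∈ EM G B ↔ ∃ x ∈ f, x ∈ B := by
  simp only [EM, Finset.mem_filter]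
  exact ⟨fun h => h.2, fun h => ⟨hf, h⟩⟩

lemma Closed.edge {V : Type} [Fintype V] {G : SimpleGraph V} {B : Set V} {v : V}
    (h : Closed G B v) {f : Sym2 V} (hf : f ∈ EM G B) : ∀ x ∈ f, x ∈ B ∨ x = v := by
  obtain ⟨h1, x, hx, hxB⟩ := Finset.mem_filter.1 hf
  intro y hy
  by_cases hyB : y ∈ B
  · exact Or.inl hyB
  · right
    have hne : x ≠ y := by rintro rfl; exact hyB hxB
    have : f = s(x, y) := (Sym2.mem_and_mem_iff hne).1 ⟨hx, hy⟩
    rw [this] at h1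
    exact h.2 x y (by simpa using h1) hxB hyB

lemma Opt.triple_aux {V : Type} [Fintype V] {G : SimpleGraph V} (hG : Opt G) {A B C : Set V} {v : V}
    (hA : Closed G A v) (hB : Closed G B v) (hAn : A.Nonempty)
    (hBn : B.Nonempty) (hC : Closed G C v) (hAB : Disjoint A B) (hAC : Disjoint A C)
    (hBC : Disjoint B C)
    (hle : (EM G B).card ≤ (EM G C).card) : False := by
  obtain ⟨x, hxB, hxv⟩ := hB.exists_adj hG.1.1 hBn
  have hconn := hG.1.1
  have hxA : x ∉ A := fun h => Set.disjoint_left.1 hAB h hxB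
  have hmove := hG.move hA hAn hxA
  set F := G.edgeFinset.filter (fun f => ∀ x ∈ f, x ∉ A) with hF
  have hsub : ∀ B : Set V, Closed G B v → Disjoint A B → EM G B ⊆ F := by
    intro B hB hAB f hf
    refine Finset.mem_filter.2 ⟨(Finset.mem_filter.1 hf).1, fun y hy hyA => ?_⟩
    rcases hB.edge hf y hy with h | h
    · exact Set.disjoint_left.1 hAB hyA h
    · exact hA.1 (h ▸ hyA)
  have hd : G.dist x v = 1 := dist_eq_one_iff_adj.2 hxv
  have hd' : G.dist v x = 1 := dist_eq_one_iff_adj.2 hxv.symm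
  have hpt : ∑ f ∈ F, (vDist G v f + (if f ∈ EM G C then 1 else 0)) ≤
      ∑ f ∈ F, (vDist G x f + (if f ∈ (EM G B).erase s(v, x) then 1 else 0)) := by
    refine Finset.sum_le_sum fun f hf => ?_
    have hfE := (Finset.mem_filter.1 hf).1
    by_cases hfB : f ∈ EM G B
    · have hfC : f ∉ EM G C := by
        intro h
        obtain ⟨y, hy, hyB⟩ := (mem_EM hfE).1 hfB
        rcases hC.edge h y hy with h | h
        · exact Set.disjoint_left.1 hBC hyB h
        · exact hB.1 (h ▸ hyB)
      rw [if_neg hfC]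
      by_cases hfx : f = s(v, x)
      · have : vDist G v f ≤ G.dist v v := vDist_le G (by rw [hfx]; simp)
        rw [SimpleGraph.dist_self] at this
        omega
      · rw [if_pos (Finset.mem_erase.2 ⟨hfx, hfB⟩)]
        have := vDist_triangle hconn v x f
        omega
    · have := hB.vDist hconn hxB (f := f) (fun w hw hwB => hfB ((mem_EM hfE).2 ⟨w, hw, hwB⟩))
      split_ifs <;> omega
  have hmem : s(v, x) ∈ EM G B :=
    (mem_EM (by simpa using hxv.symm)).2 ⟨x, by simp, hxB⟩
  rw [Finset.sum_add_distrib, Finset.sum_add_distrib, sum_ind _ _ (hsub C hC hAC),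
    sum_ind _ _ ((Finset.erase_subset _ _).trans (hsub B hB hAB)), Finset.card_erase_of_mem hmem] at hpt
  have : 0 < (EM G B).card := Finset.card_pos.2 ⟨_, hmem⟩
  omega

theorem Opt.triple {V : Type} [Fintype V] {G : SimpleGraph V} (hG : Opt G) {A B C : Set V} {v : V}
    (hA : Closed G A v) (hB : Closed G B v) (hC : Closed G C v) (hAn : A.Nonempty)
    (hBn : B.Nonempty) (hCn : C.Nonempty) (hAB : Disjoint A B) (hAC : Disjoint A C)
    (hBC : Disjoint B C) : False := by
  rcases le_total (EM G B).card (EM G C).card with h | h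
  · exact hG.triple_aux hA hB hAn hBn hC hAB hAC hBC h
  · exact hG.triple_aux hA hC hAn hCn hB hAC hAB hBC.symm h

lemma Opt.triangle_aux {V : Type} [Fintype V] {G : SimpleGraph V} (hG : Opt G) {A B C : Set V}
    {z1 z2 z3 : V} (h12 : G.Adj z1 z2) (h13 : G.Adj z1 z3) (h23 : G.Adj z2 z3)
    (hA : Closed G A z1) (hB : Closed G B z2) (hC : Closed G C z3) (hAn : A.Nonempty)
    (hBn : B.Nonempty) (hAB : Disjoint A B) (hAC : Disjoint A C)
    (hBC : Disjoint B C) (hA2 : z2 ∉ A) (hA3 : z3 ∉ A) (hB1 : z1 ∉ B) (hB3 : z3 ∉ B)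
    (hC1 : z1 ∉ C) (hC2 : z2 ∉ C)
    (hle : (EM G B).card ≤ (EM G C).card) : False := by
  have hconn := hG.1.1
  obtain ⟨x, hxB, hmax⟩ := Set.exists_max_image B (fun x => G.dist z2 x) (Set.toFinite B) hBn
  set e := G.dist z2 x with he
  have he1 : 1 ≤ e := hconn.pos_dist_of_ne (by rintro rfl; exact hB.1 hxB)
  have hxA : x ∉ A := fun h => Set.disjoint_left.1 hAB h hxB
  have hmove := hG.move hA hAn hxA
  set F := G.edgeFinset.filter (fun f => ∀ x ∈ f, x ∉ A) with hF
  have hsub : ∀ (B : Set V) (v : V), Closed G B v → Disjoint A B → v ∉ A → EM G B ⊆ F := by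
    intro B v hB hAB hv f hf
    refine Finset.mem_filter.2 ⟨(Finset.mem_filter.1 hf).1, fun y hy hyA => ?_⟩
    rcases hB.edge hf y hy with h | h
    · exact Set.disjoint_left.1 hAB hyA h
    · exact hv (h ▸ hyA)
  have hd12 : G.dist z1 z2 = 1 := dist_eq_one_iff_adj.2 h12
  have hd13 : G.dist z1 z3 = 1 := dist_eq_one_iff_adj.2 h13
  have hd23 : G.dist z2 z3 = 1 := dist_eq_one_iff_adj.2 h23
  set I := G.edgeFinset.filter (fun f => x ∈ f) with hI
  have hIB : I ⊆ EM G B := by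
    intro f hf
    obtain ⟨h1, h2⟩ := Finset.mem_filter.1 hf
    exact (mem_EM h1).2 ⟨x, h2, hxB⟩
  have hx12 : s(z1, z2) ∈ F := by
    refine Finset.mem_filter.2 ⟨by simpa using h12, ?_⟩
    simp [hA.1, hA2]
  have hx13 : s(z1, z3) ∈ F := by
    refine Finset.mem_filter.2 ⟨by simpa using h13, ?_⟩
    simp [hA.1, hA3]
  have hdxz : G.dist x z2 = e := dist_comm
  have hpt : ∑ f ∈ F, (vDist G z1 f + (if f ∈ EM G C then e else 0) +
      (if f ∈ ({s(z1, z2)} : Finset (Sym2 V)) then 1 else 0) + 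
      (if f ∈ ({s(z1, z3)} : Finset (Sym2 V)) then 2 else 0)) ≤
      ∑ f ∈ F, (vDist G x f + (if f ∈ EM G B then e else 0) + (if f ∈ I then 1 else 0)) := by
    refine Finset.sum_le_sum fun f hf => ?_
    have hfE := (Finset.mem_filter.1 hf).1
    have hn12 : f ∈ EM G B ∨ f ∈ EM G C → f ∉ ({s(z1, z2)} : Finset (Sym2 V)) := by
      intro h h'
      rw [Finset.mem_singleton] at h'
      rw [mem_EM hfE, mem_EM hfE] at h
      subst h'
      simp only [Sym2.mem_iff, exists_eq_or_imp, exists_eq_left] at h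
      have := hB.1
      tauto
    have hn13 : f ∈ EM G B ∨ f ∈ EM G C → f ∉ ({s(z1, z3)} : Finset (Sym2 V)) := by
      intro h h'
      rw [Finset.mem_singleton] at h'
      rw [mem_EM hfE, mem_EM hfE] at h
      subst h'
      simp only [Sym2.mem_iff, exists_eq_or_imp, exists_eq_left] at h
      have := hC.1
      tauto
    by_cases hfB : f ∈ EM G B
    · have hfC : f ∉ EM G C := by
        intro h
        obtain ⟨y, hy, hyB⟩ := (mem_EM hfE).1 hfB
        rcases hC.edge h y hy with h | h
        · exact Set.disjoint_left.1 hBC hyB h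
        · exact hB3 (h ▸ hyB)
      rw [if_neg hfC, if_neg (hn12 (Or.inl hfB)), if_neg (hn13 (Or.inl hfB)), if_pos hfB,
        hB.vDist' hconn hB1 (hB.edge hfB)]
      by_cases hfx : f ∈ I
      · rw [if_pos hfx]
        have := vDist_le G (v := z2) (Finset.mem_filter.1 hfx).2
        omega
      · rw [if_neg hfx]
        obtain ⟨y, hy, hyB⟩ := (mem_EM hfE).1 hfB
        have h1 := vDist_le G (v := z2) hy
        have h2 := hmax y hyB
        obtain ⟨w, hw, h3⟩ := vDist_exists G x f
        have h4 : 0 < G.dist x w := hconn.pos_dist_of_ne (by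
          rintro rfl
          exact hfx (Finset.mem_filter.2 ⟨hfE, hw⟩))
        omega
    · have h1 := hB.vDist hconn hxB (f := f) (fun w hw hwB => hfB ((mem_EM hfE).2 ⟨w, hw, hwB⟩))
      by_cases hfC : f ∈ EM G C
      · rw [if_pos hfC, if_neg (hn12 (Or.inr hfC)), if_neg (hn13 (Or.inr hfC)), if_neg hfB, h1,
          hC.vDist' hconn hC1 (hC.edge hfC), hC.vDist' hconn hC2 (hC.edge hfC)]
        omega
      · rw [if_neg hfC, if_neg hfB]
        by_cases h12' : f = s(z1, z2)
        · have h13' : f ∉ ({s(z1, z3)} : Finset (Sym2 V)) := by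
            rw [h12', Finset.mem_singleton]
            intro h
            exact h23.ne (Sym2.congr_right.1 h)
          rw [if_neg h13', if_pos (Finset.mem_singleton.2 h12')]
          have : vDist G z1 f ≤ G.dist z1 z1 := vDist_le G (by rw [h12']; simp)
          rw [SimpleGraph.dist_self] at this
          omega
        · rw [if_neg (by rwa [Finset.mem_singleton])]
          by_cases h13' : f = s(z1, z3)
          · rw [if_pos (Finset.mem_singleton.2 h13')]
            have : vDist G z1 f ≤ G.dist z1 z1 := vDist_le G (by rw [h13']; simp)
            rw [SimpleGraph.dist_self] at this
            obtain ⟨w, hw, h3⟩ := vDist_exists G z2 f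
            have h4 : 0 < G.dist z2 w := hconn.pos_dist_of_ne (by
              rintro rfl
              rw [h13'] at hw
              simp [h12.ne', h23.ne] at hw)
            omega
          · rw [if_neg (by rwa [Finset.mem_singleton])]
            have := vDist_triangle hconn z1 z2 f
            omega
  rw [Finset.sum_add_distrib, Finset.sum_add_distrib, Finset.sum_add_distrib,
    Finset.sum_add_distrib, Finset.sum_add_distrib, sum_ind _ _ (hsub C z3 hC hAC hA3),
    sum_ind _ _ (hsub B z2 hB hAB hA2), sum_ind _ _ (hIB.trans (hsub B z2 hB hAB hA2)),
    sum_ind _ _ (Finset.singleton_subset_iff.2 hx12),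
    sum_ind _ _ (Finset.singleton_subset_iff.2 hx13), Finset.card_singleton,
    Finset.card_singleton] at hpt
  have hmul := Nat.mul_le_mul_left e hle
  have hI3 : 2 < I.card := by omega
  obtain ⟨a, b, c, ha, hb, hc, hab, hac, hbc⟩ := Finset.two_lt_card_iff.1 hI3
  have hget : ∀ f ∈ I, ∃ y, f = s(x, y) ∧ G.Adj x y := by
    intro f hf
    obtain ⟨h1, h2⟩ := Finset.mem_filter.1 hf
    obtain ⟨y, rfl⟩ := h2
    exact ⟨y, rfl, by simpa using h1⟩
  obtain ⟨y1, rfl, h1⟩ := hget a ha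
  obtain ⟨y2, rfl, h2⟩ := hget b hb
  obtain ⟨y3, rfl, h3⟩ := hget c hc
  refine Cac.deg_le_two (G := G) hG.1.2 (x := x) (r := z2) ?_ h1 h2 h3 (by rintro rfl; exact hab rfl)
    (by rintro rfl; exact hac rfl) (by rintro rfl; exact hbc rfl)
  intro y hy
  obtain ⟨w, hw⟩ := hconn.exists_walk_length_eq_dist y z2
  refine ⟨w, fun hx => ?_⟩
  have h5 : w.length = (w.takeUntil x hx).length + (w.dropUntil x hx).length := by
    rw [← Walk.length_append, Walk.take_spec]
  have h6 := dist_le (w.dropUntil x hx)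
  have h7 := dist_le (w.takeUntil x hx)
  have h8 : G.dist y x = 1 := dist_eq_one_iff_adj.2 hy.symm
  have h9 : y ∈ B ∨ y = z2 := by
    by_cases hyB : y ∈ B
    · exact Or.inl hyB
    · exact Or.inr (hB.2 x y hy hxB hyB)
  rcases h9 with h9 | rfl
  · have h10 : G.dist y z2 ≤ e := by rw [dist_comm]; exact hmax y h9
    omega
  · rw [SimpleGraph.dist_self] at hw; omega

theorem Opt.triangle {V : Type} [Fintype V] {G : SimpleGraph V} (hG : Opt G) {A B C : Set V}
    {z1 z2 z3 : V} (h12 : G.Adj z1 z2) (h13 : G.Adj z1 z3) (h23 : G.Adj z2 z3)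
    (hA : Closed G A z1) (hB : Closed G B z2) (hC : Closed G C z3) (hAn : A.Nonempty)
    (hBn : B.Nonempty) (hCn : C.Nonempty) (hAB : Disjoint A B) (hAC : Disjoint A C)
    (hBC : Disjoint B C) (hA2 : z2 ∉ A) (hA3 : z3 ∉ A) (hB1 : z1 ∉ B) (hB3 : z3 ∉ B)
    (hC1 : z1 ∉ C) (hC2 : z2 ∉ C) : False := by
  rcases le_total (EM G B).card (EM G C).card with h | h
  · exact hG.triangle_aux h12 h13 h23 hA hB hC hAn hBn hAB hAC hBC hA2 hA3 hB1 hB3 hC1 hC2 h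
  · exact hG.triangle_aux h13 h12 h23.symm hA hC hB hAn hCn hAC hAB hBC.symm hA3 hA2 hC1 hC2 hB1
      hB3 h

end S16


namespace S16

/-- An indexed cycle of a cactus with its gate projection. -/
structure Cyc {V : Type} (G : SimpleGraph V) where
  k : ℕ
  hk : 3 ≤ k
  K : Set V
  z : ℕ → V
  idx : V → ℕ
  pr : V → V
  z_mem : ∀ i < k, z i ∈ K
  idx_z : ∀ i < k, idx (z i) = i
  idx_lt : ∀ x ∈ K, idx x < k
  z_idx : ∀ x ∈ K, z (idx x) = x
  pr_mem : ∀ x, pr x ∈ K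
  pr_id : ∀ x ∈ K, pr x = x
  adj_out : ∀ x y, G.Adj x y → x ∉ K → pr x = pr y
  adj : ∀ i, i + 1 < k → G.Adj (z i) (z (i + 1))
  adj0 : G.Adj (z (k - 1)) (z 0)
  chord : ∀ i j, i < j → j < k → G.Adj (z i) (z j) → j = i + 1 ∨ (i = 0 ∧ j = k - 1)

/-- `y` reaches the set `K` at the vertex `p` -/
def Gate {V : Type} (G : SimpleGraph V) (K : Set V) (y p : V) : Prop :=
  p ∈ K ∧ ∃ b, ∃ w : G.Walk y b, (∀ x ∈ w.support, x ∉ K) ∧ G.Adj b p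

lemma gate_exists {V : Type} {G : SimpleGraph V} {K : Set V} {y u : V} (w : G.Walk y u)
    (hy : y ∉ K) (hu : u ∈ K) : ∃ p, Gate G K y p := by
  induction w with
  | nil => exact absurd hu hy
  | @cons a b c hab w ih =>
    by_cases hb : b ∈ K
    · exact ⟨b, hb, a, Walk.nil, by simpa using hy, hab⟩
    · obtain ⟨p, hp, d, w', hw', hd⟩ := ih hb hu
      refine ⟨p, hp, d, Walk.cons hab w', ?_, hd⟩
      intro x hx
      rw [Walk.support_cons, List.mem_cons] at hx
      rcases hx with rfl | hx
      · exact hy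
      · exact hw' x hx

lemma gate_unique {V : Type} {G : SimpleGraph V} (hG : Cac G) {u : V} {c : G.Walk u u}
    (hc : c.IsCycle) {y p q : V} (hp : Gate G {x | x ∈ c.support} y p)
    (hq : Gate G {x | x ∈ c.support} y q) : p = q := by
  by_contra hpq
  obtain ⟨hpK, b, w, hw, hb⟩ := hp
  obtain ⟨hqK, b', w', hw', hb'⟩ := hq
  refine hG.no_ear hc hpK hqK hpq hb.symm ?_ (w.reverse.append (w'.append (Walk.cons hb' Walk.nil))) ?_
  · intro h
    exact hw b (by simp) (Walk.snd_mem_support_of_mem_edges c h)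
  · simp only [Walk.mem_support_append_iff, Walk.support_reverse, List.mem_reverse,
      Walk.support_cons, Walk.support_nil, List.mem_cons, List.not_mem_nil, or_false]
    rintro (h | h | h | h)
    · exact hw p h hpK
    · exact hw' p h hpK
    · rw [h] at hpK
      exact hw' b' (by simp) hpK
    · exact hpq h

theorem cyc_of {V : Type} {G : SimpleGraph V} (hG : IsCactus G) {u : V} {c : G.Walk u u}
    (hc : c.IsCycle) : ∃ d : Cyc G, d.K = {x | x ∈ c.support} := by
  have hcac : Cac G := hG.2
  have hg : ∀ x, ∃ p ∈ c.support, (x ∈ c.support → p = x) ∧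
      (x ∉ c.support → Gate G {x | x ∈ c.support} x p) := by
    intro x
    by_cases hx : x ∈ c.support
    · exact ⟨x, hx, fun _ => rfl, fun h => absurd hx h⟩
    · obtain ⟨w⟩ := hG.1 x u
      obtain ⟨p, hp⟩ := gate_exists (K := {x | x ∈ c.support}) w hx (by simp)
      exact ⟨p, hp.1, fun h => absurd h hx, fun _ => hp⟩
  choose pr hpr1 hpr2 hpr3 using hg
  have h3 := hc.three_le_length
  have hi : ∀ x, ∃ i, x ∈ c.support → i < c.length ∧ c.getVert i = x := by
    intro x
    by_cases hx : x ∈ c.support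
    · obtain ⟨i, hi, hil⟩ := Walk.mem_support_iff_exists_getVert.1 hx
      rcases hil.lt_or_eq with h | h
      · exact ⟨i, fun _ => ⟨h, hi⟩⟩
      · refine ⟨0, fun _ => ⟨by omega, ?_⟩⟩
        rw [← hi, h, Walk.getVert_zero, Walk.getVert_length]
    · exact ⟨0, fun h => absurd h hx⟩
  choose idx hidx using hi
  have hinj : ∀ i j, i < c.length → j < c.length → c.getVert i = c.getVert j → i = j := by
    intro i j h1 h2 h
    exact hc.getVert_injOn' (by simp; omega) (by simp; omega) h
  refine ⟨⟨c.length, h3, {x | x ∈ c.support}, c.getVert, idx, pr, ?_, ?_, ?_, ?_, hpr1, hpr2,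
    ?_, ?_, ?_, ?_⟩, rfl⟩
  · intro i _
    exact c.getVert_mem_support i
  · intro i h
    have := hidx (c.getVert i) (c.getVert_mem_support i)
    exact hinj _ _ this.1 h this.2
  · intro x hx; exact (hidx x hx).1
  · intro x hx; exact (hidx x hx).2
  · intro x y h hx
    have hgx := hpr3 x hx
    by_cases hy : y ∈ c.support
    · rw [hpr2 y hy]
      exact gate_unique hcac hc hgx ⟨hy, x, Walk.nil, by simpa using hx, h⟩
    · obtain ⟨hpK, b, w, hw, hb⟩ := hpr3 y hy
      refine gate_unique hcac hc hgx ⟨hpK, b, Walk.cons h w, ?_, hb⟩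
      intro z hz
      rw [Walk.support_cons, List.mem_cons] at hz
      rcases hz with rfl | hz
      · exact hx
      · exact hw z hz
  · intro i h
    exact c.adj_getVert_succ (by omega)
  · have := c.adj_getVert_succ (i := c.length - 1) (by omega)
    rw [Nat.sub_add_cancel (by omega), Walk.getVert_length] at this
    rwa [Walk.getVert_zero]
  · intro i j hij hj h
    have he : s(c.getVert i, c.getVert j) ∈ c.edges := by
      by_contra hne
      refine hcac.no_ear hc (c.getVert_mem_support i) (c.getVert_mem_support j) h.ne h hne
        Walk.nil ?_
      simpa using h.ne
    obtain ⟨m, hm, hm'⟩ := (Walk.mk_mem_edges_iff_exists c).1 he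
    have hlast : c.getVert c.length = c.getVert 0 := by
      rw [Walk.getVert_zero, Walk.getVert_length]
    rcases Sym2.eq_iff.1 hm' with ⟨e1, e2⟩ | ⟨e1, e2⟩
    · have := hinj _ _ hm (hij.trans hj) e1
      subst this
      rcases (Nat.succ_le_of_lt hm).lt_or_eq with h | h
      · left; exact (hinj _ _ h hj e2).symm
      · change m + 1 = _ at h
        rw [h, hlast] at e2
        have := hinj _ _ (by omega) hj e2
        omega
    · have := hinj _ _ hm hj e1
      subst this
      rcases (Nat.succ_le_of_lt hm).lt_or_eq with h | h
      · have := hinj _ _ h (by omega) e2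
        omega
      · change m + 1 = _ at h
        rw [h, hlast] at e2
        have := hinj _ _ (by omega) (by omega) e2
        omega

end S16


namespace S16

/-- the cyclic offset from `a` to `b` modulo `k` -/
def rho (k a b : ℕ) : ℕ := if a ≤ b then b - a else b + k - a

lemma sum_rho_right (k a : ℕ) (ha : a < k) (φ : ℕ → ℕ) :
    ∑ b ∈ range k, φ (rho k a b) = ∑ r ∈ range k, φ r := by
  refine Finset.sum_nbij' (fun b => rho k a b) (fun r => if r + a < k then r + a else r + a - k)
    ?_ ?_ ?_ ?_ ?_
  · intro b hb
    simp only [Finset.mem_range, rho] at *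
    split_ifs <;> omega
  · intro b hb
    simp only [Finset.mem_range] at *
    split_ifs <;> omega
  · intro b hb
    simp only [Finset.mem_range, rho] at *
    split_ifs <;> omega
  · intro b hb
    simp only [Finset.mem_range, rho] at *
    split_ifs <;> omega
  · intro b hb; rfl

lemma sum_rho_left (k a : ℕ) (ha : a < k) (φ : ℕ → ℕ) :
    ∑ s ∈ range k, φ (rho k s a) = ∑ r ∈ range k, φ r := by
  refine Finset.sum_nbij' (fun b => rho k b a) (fun b => rho k b a)
    ?_ ?_ ?_ ?_ ?_
  · intro b hb
    simp only [Finset.mem_range, rho] at *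
    split_ifs <;> omega
  · intro b hb
    simp only [Finset.mem_range, rho] at *
    split_ifs <;> omega
  · intro b hb
    simp only [Finset.mem_range, rho] at *
    split_ifs <;> omega
  · intro b hb
    simp only [Finset.mem_range, rho] at *
    split_ifs <;> omega
  · intro b hb; rfl

/-- the total distance on a cycle of length `k` -/
def DD (k : ℕ) : ℕ := ∑ s ∈ range k, min s (k - s)

lemma DD_succ (m : ℕ) : ∑ s ∈ range (m + 1), min s (m - s) = DD m := by
  rw [Finset.sum_range_succ]; simp [DD]

lemma DD_rec (k : ℕ) : DD (k + 2) = DD k + k + 1 := by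
  unfold DD
  rw [Finset.sum_range_succ', ]
  have : ∀ s ∈ range (k + 1), min (s + 1) (k + 2 - (s + 1)) = min s (k - s) + 1 := by
    intro s hs
    simp only [Finset.mem_range] at hs
    omega
  rw [Finset.sum_congr rfl this, Finset.sum_add_distrib, DD_succ]
  simp [DD]
  omega

lemma DD_le : ∀ k : ℕ, 4 * DD k ≤ k ^ 2
  | 0 => by simp [DD]
  | 1 => by simp [DD]
  | k + 2 => by
    have := DD_le k
    rw [DD_rec]
    nlinarith

/-- separation count for the rotating half-cuts -/
lemma cut_count_aux (k a b : ℕ) (ha : a < k) (hb : b < k) (hm : rho k a b ≤ k / 2) :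
    2 * rho k a b ≤ ((range k).filter
      (fun s => ¬ (rho k s a < k / 2 ↔ rho k s b < k / 2))).card := by
  set m := rho k a b with hmdef
  set h := k / 2 with hh
  have h1 : ((range k).filter (fun s => ¬ (rho k s a < h ↔ rho k s b < h))).card =
      ∑ s ∈ range k, (fun r => if ¬ (r < h ↔ (if r + m < k then r + m else r + m - k) < h)
        then 1 else 0) (rho k s a) := by
    rw [Finset.card_filter]
    refine Finset.sum_congr rfl fun s hs => ?_
    have : (if rho k s a + m < k then rho k s a + m else rho k s a + m - k) = rho k s b := by
      simp only [Finset.mem_range] at hs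
      rw [hmdef]
      unfold rho
      split_ifs <;> omega
    simp only [this]
  have h3 := h1.trans (sum_rho_left k a ha (fun r => if ¬ (r < h ↔
    (if r + m < k then r + m else r + m - k) < h) then 1 else 0))
  beta_reduce at h3
  rw [h3, ← Finset.card_filter]
  have h2 : Finset.Ico (h - m) h ∪ Finset.Ico (k - m) k ⊆ (range k).filter
      (fun r => ¬ (r < h ↔ (if r + m < k then r + m else r + m - k) < h)) := by
    intro r hr
    simp only [Finset.mem_union, Finset.mem_Ico, Finset.mem_filter, Finset.mem_range] at *
    split_ifs <;> omega
  refine le_trans ?_ (Finset.card_le_card h2)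
  rw [Finset.card_union_of_disjoint]
  · simp; omega
  · rw [Finset.disjoint_left]
    intro r
    simp only [Finset.mem_Ico]
    omega

lemma cut_count (k a b : ℕ) (ha : a < k) (hb : b < k) :
    2 * min (rho k a b) (rho k b a) ≤ ((range k).filter
      (fun s => ¬ (rho k s a < k / 2 ↔ rho k s b < k / 2))).card := by
  by_cases h : rho k a b ≤ k / 2
  · exact (Nat.mul_le_mul_left 2 (min_le_left _ _)).trans (cut_count_aux k a b ha hb h)
  · have h' : rho k b a ≤ k / 2 := by
      unfold rho at *
      split_ifs at * <;> omega
    refine (Nat.mul_le_mul_left 2 (min_le_right _ _)).trans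
      ((cut_count_aux k b a hb ha h').trans_eq ?_)
    congr 1
    ext s
    simp only [Finset.mem_filter, Iff.comm]

/-- absolute difference -/
def ad (i j : ℕ) : ℕ := (i - j) + (j - i)

lemma sum_sub_range (n : ℕ) : 2 * ∑ i ∈ range n, (n - i) = n * (n + 1) := by
  have : ∑ i ∈ range n, (n - i) = ∑ i ∈ range n, (i + 1) := by
    rw [← Finset.sum_range_reflect]
    refine Finset.sum_congr rfl fun i hi => ?_
    simp only [Finset.mem_range] at hi
    omega
  rw [this]
  induction n with
  | zero => simp
  | succ n ih =>
    rw [Finset.sum_range_succ, Nat.mul_add, ih (by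
      rw [← Finset.sum_range_reflect]
      refine Finset.sum_congr rfl fun i hi => ?_
      simp only [Finset.mem_range] at hi
      omega)]
    ring

lemma sum_ad (n : ℕ) : 3 * ∑ i ∈ range n, ∑ j ∈ range n, ad i j + n = n ^ 3 := by
  induction n with
  | zero => simp
  | succ n ih =>
    have h1 : ∑ i ∈ range n, ad i n = ∑ i ∈ range n, (n - i) := by
      refine Finset.sum_congr rfl fun i hi => ?_
      simp only [Finset.mem_range, ad] at *
      omega
    have h2 : ∑ i ∈ range n, ad n i = ∑ i ∈ range n, (n - i) := by
      refine Finset.sum_congr rfl fun i hi => ?_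
      simp only [Finset.mem_range, ad] at *
      omega
    have h3 := sum_sub_range n
    simp only [Finset.sum_range_succ, Finset.sum_add_distrib, h1, h2]
    have h4 : ad n n = 0 := by simp [ad]
    rw [h4]
    nlinarith

/-- levels of the lollipop edges -/
def al (k i : ℕ) : ℕ := if i = k - 1 then k - 3 else i

/-- lower bound for edge distances in the lollipop -/
def lam (k i j : ℕ) : ℕ := if i = j then 0 else max 1 (ad (al k i) (al k j))

lemma sum_lam (k : ℕ) (hk : 4 ≤ k) :
    k * DD k ≤ ∑ i ∈ range k, ∑ j ∈ range k, lam k i j + 2 := by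
  obtain ⟨n, rfl⟩ : ∃ n, k = n + 2 := ⟨k - 2, by omega⟩
  have hD := DD_le (n + 2)
  have h0 : ∀ i ∈ range n, ∀ j ∈ range n, lam (n + 2) i j = ad i j := by
    intro i hi j hj
    simp only [Finset.mem_range, lam, al, ad] at *
    split_ifs <;> omega
  have h1 : ∑ i ∈ range n, ∑ j ∈ range n, lam (n + 2) i j = ∑ i ∈ range n, ∑ j ∈ range n, ad i j :=
    Finset.sum_congr rfl fun i hi => Finset.sum_congr rfl fun j hj => h0 i hi j hj
  have h2 : ∑ i ∈ range n, lam (n + 2) i n = ∑ i ∈ range n, (n - i) := by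
    refine Finset.sum_congr rfl fun i hi => ?_
    simp only [Finset.mem_range, lam, al, ad] at *
    split_ifs <;> omega
  have h3 : ∑ i ∈ range n, lam (n + 2) n i = ∑ i ∈ range n, (n - i) := by
    refine Finset.sum_congr rfl fun i hi => ?_
    simp only [Finset.mem_range, lam, al, ad] at *
    split_ifs <;> omega
  have h45 : ∑ i ∈ range n, (n - i) + 1 = ∑ i ∈ range n, max 1 (n - 1 - i) + n := by
    obtain ⟨p, rfl⟩ : ∃ p, n = p + 1 := ⟨n - 1, by omega⟩
    rw [Finset.sum_range_succ, Finset.sum_range_succ (fun i => max 1 (p + 1 - 1 - i))]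
    have : ∑ i ∈ range p, (p + 1 - i) = ∑ i ∈ range p, (max 1 (p + 1 - 1 - i) + 1) := by
      refine Finset.sum_congr rfl fun i hi => ?_
      simp only [Finset.mem_range] at *
      omega
    rw [this, Finset.sum_add_distrib]
    simp
    omega
  have h4 : ∑ i ∈ range n, lam (n + 2) i (n + 1) = ∑ i ∈ range n, max 1 (n - 1 - i) := by
    refine Finset.sum_congr rfl fun i hi => ?_
    simp only [Finset.mem_range, lam, al, ad] at *
    split_ifs <;> omega
  have h5 : ∑ i ∈ range n, lam (n + 2) (n + 1) i = ∑ i ∈ range n, max 1 (n - 1 - i) := by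
    refine Finset.sum_congr rfl fun i hi => ?_
    simp only [Finset.mem_range, lam, al, ad] at *
    split_ifs <;> omega
  have h6 : lam (n + 2) n (n + 1) = 1 := by
    simp only [lam, al, ad]
    split_ifs <;> omega
  have h7 : lam (n + 2) (n + 1) n = 1 := by
    simp only [lam, al, ad]
    split_ifs <;> omega
  have h8 : ∀ i, lam (n + 2) i i = 0 := by simp [lam]
  simp only [Finset.sum_range_succ, Finset.sum_add_distrib, h1, h2, h3, h4, h5, h6, h7, h8]
  have h9 := sum_ad n
  have h10 := sum_sub_range n
  set S := ∑ i ∈ range n, ∑ j ∈ range n, ad i j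
  set T := ∑ i ∈ range n, (n - i)
  set U := ∑ i ∈ range n, max 1 (n - 1 - i)
  have hn : 2 ≤ n := by omega
  have key : (n + 2) * (4 * DD (n + 2)) ≤ (n + 2) * (n + 2) ^ 2 := Nat.mul_le_mul_left _ hD
  have key2 : 40 * n ≤ n ^ 3 + 6 * n ^ 2 + 48 := by
    obtain ⟨p, rfl⟩ := Nat.exists_eq_add_of_le hn
    rcases Nat.eq_zero_or_pos p with rfl | hp
    · norm_num
    · nlinarith [Nat.zero_le (p ^ 3)]
  nlinarith

end S16


namespace S16

lemma sep_sum {α : Type} (N : Finset α) (P : α → Prop) (c : ℕ) :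
    ∑ e ∈ N, ∑ f ∈ N, (if ¬ (P e ↔ P f) then c else 0) =
      2 * c * ((N.filter P).card * (N.filter (fun e => ¬ P e)).card) := by
  have h1 : ∀ e ∈ N.filter P, ∑ f ∈ N, (if ¬ (P e ↔ P f) then c else 0) =
      (N.filter (fun e => ¬ P e)).card * c := by
    intro e he
    have := (Finset.mem_filter.1 he).2
    simp only [this, true_iff]
    rw [← Finset.sum_filter]
    simp
  have h2 : ∀ e ∈ N.filter (fun e => ¬ P e), ∑ f ∈ N, (if ¬ (P e ↔ P f) then c else 0) =
      (N.filter P).card * c := by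
    intro e he
    have := (Finset.mem_filter.1 he).2
    simp only [this, false_iff, not_not]
    rw [← Finset.sum_filter]
    simp
  rw [← Finset.sum_filter_add_sum_filter_not N P, Finset.sum_congr rfl h1, Finset.sum_congr rfl h2]
  simp only [Finset.sum_const, smul_eq_mul]
  ring

lemma exists_cut {α : Type} (k : ℕ) (hk : 0 < k) (N : Finset α) (r : α → ℕ) (hr : ∀ e ∈ N, r e < k)
    (D : α → α → ℕ) (hD : ∀ e ∈ N, ∀ f ∈ N, D e f ≤ min (rho k (r e) (r f)) (rho k (r f) (r e))) :
    ∃ s, ∑ e ∈ N, ∑ f ∈ N, D e f ≤ k * ((N.filter (fun e => rho k s (r e) < k / 2)).card *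
      (N.filter (fun e => ¬ rho k s (r e) < k / 2)).card) := by
  set M : ℕ → ℕ := fun s => (N.filter (fun e => rho k s (r e) < k / 2)).card *
      (N.filter (fun e => ¬ rho k s (r e) < k / 2)).card with hM
  obtain ⟨s, -, hs⟩ := Finset.exists_max_image (range k) M ⟨0, by simpa using hk⟩
  refine ⟨s, ?_⟩
  have h1 : 2 * ∑ e ∈ N, ∑ f ∈ N, D e f ≤ ∑ s ∈ range k, 2 * M s := by
    have h2 : ∑ s ∈ range k, 2 * M s = ∑ e ∈ N, ∑ f ∈ N, ∑ s ∈ range k,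
        (if ¬ (rho k s (r e) < k / 2 ↔ rho k s (r f) < k / 2) then 1 else 0) := by
      rw [Finset.sum_congr rfl (fun e _ => Finset.sum_comm), Finset.sum_comm]
      refine Finset.sum_congr rfl fun s _ => ?_
      have := sep_sum N (fun e => rho k s (r e) < k / 2) 1
      rw [mul_one] at this
      rw [hM]
      convert this.symm
    rw [h2, Finset.mul_sum]
    refine Finset.sum_le_sum fun e he => ?_
    rw [Finset.mul_sum]
    refine Finset.sum_le_sum fun f hf => ?_
    rw [← Finset.card_filter]
    refine le_trans (Nat.mul_le_mul_left 2 (hD e he f hf)) ?_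
    convert cut_count k (r e) (r f) (hr e he) (hr f hf) using 2
  have h3 : ∑ s ∈ range k, 2 * M s ≤ ∑ _s ∈ range k, 2 * M s :=
    Finset.sum_le_sum fun t ht => Nat.mul_le_mul_left 2 (hs t ht)
  rw [Finset.sum_const, Finset.card_range, smul_eq_mul] at h3
  have h4 : k * (2 * M s) = 2 * (k * M s) := by ring
  change _ ≤ k * M s
  omega

namespace Cyc

variable {V : Type} {G : SimpleGraph V} (d : Cyc G)

/-- cyclic successor -/
def nx (i : ℕ) : ℕ := if i + 1 = d.k then 0 else i + 1

lemma nx_lt {i : ℕ} (hi : i < d.k) : d.nx i < d.k := by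
  have := d.hk
  unfold nx; split_ifs <;> omega

/-- the edges of the cycle -/
def fe (i : ℕ) : Sym2 V := s(d.z i, d.z (d.nx i))

lemma z_inj {i j : ℕ} (hi : i < d.k) (hj : j < d.k) (h : d.z i = d.z j) : i = j := by
  rw [← d.idx_z i hi, h, d.idx_z j hj]

lemma fe_inj : Set.InjOn d.fe (range d.k : Finset ℕ) := by
  intro i hi j hj h
  simp only [Finset.coe_range, Set.mem_Iio] at hi hj
  have hk := d.hk
  rcases Sym2.eq_iff.1 h with ⟨h1, -⟩ | ⟨h1, h2⟩
  · exact d.z_inj hi hj h1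
  · have e1 := d.z_inj hi (d.nx_lt hj) h1
    have e2 := d.z_inj (d.nx_lt hi) hj h2
    unfold nx at e1 e2
    split_ifs at e1 e2 <;> omega

lemma adj_nx {i : ℕ} (hi : i < d.k) : G.Adj (d.z i) (d.z (d.nx i)) := by
  unfold nx
  split_ifs with h
  · have := d.adj0
    rwa [show d.k - 1 = i by omega] at this
  · exact d.adj i (by omega)

lemma chord_nx {i j : ℕ} (hi : i < d.k) (hj : j < d.k) (h : G.Adj (d.z i) (d.z j)) :
    j = d.nx i ∨ i = d.nx j := by
  have hk := d.hk
  rcases lt_trichotomy i j with h1 | h1 | h1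
  · rcases d.chord i j h1 hj h with h2 | ⟨h2, h3⟩
    · left; unfold nx; split_ifs <;> omega
    · right; unfold nx; split_ifs <;> omega
  · subst h1; exact absurd rfl h.ne
  · rcases d.chord j i h1 hi h.symm with h2 | ⟨h2, h3⟩
    · right; unfold nx; split_ifs <;> omega
    · left; unfold nx; split_ifs <;> omega

lemma core_eq [Fintype V] : G.edgeFinset.filter (fun e => ∀ x ∈ e, x ∈ d.K) =
    (range d.k).image d.fe := by
  ext e
  induction e using Sym2.ind with
  | _ x y =>
    simp only [mem_edgeFinset, mem_edgeSet, Finset.mem_filter, Sym2.mem_iff, forall_eq_or_imp,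
        forall_eq, Finset.mem_image, Finset.mem_range]
    constructor
    · rintro ⟨h, hx, hy⟩
      rw [← d.z_idx x hx, ← d.z_idx y hy] at h
      rcases d.chord_nx (d.idx_lt x hx) (d.idx_lt y hy) h with h1 | h1
      · refine ⟨d.idx x, d.idx_lt x hx, ?_⟩
        unfold fe
        rw [← h1, d.z_idx x hx, d.z_idx y hy]
      · refine ⟨d.idx y, d.idx_lt y hy, ?_⟩
        unfold fe
        rw [← h1, d.z_idx x hx, d.z_idx y hy, Sym2.eq_swap]
    · rintro ⟨i, hi, h⟩
      have h1 := d.adj_nx hi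
      have h2 := d.z_mem i hi
      have h3 := d.z_mem _ (d.nx_lt hi)
      rcases Sym2.eq_iff.1 h with ⟨rfl, rfl⟩ | ⟨rfl, rfl⟩
      · exact ⟨h1, h2, h3⟩
      · exact ⟨h1.symm, h3, h2⟩

lemma dist_up (hG : G.Connected) {a b : ℕ} (hab : a ≤ b) (hb : b < d.k) :
    G.dist (d.z a) (d.z b) ≤ b - a := by
  induction b, hab using Nat.le_induction with
  | base => simp
  | succ b hab ih =>
    have h1 := ih (by omega)
    have h2 : G.dist (d.z b) (d.z (b + 1)) = 1 := dist_eq_one_iff_adj.2 (d.adj b hb)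
    have h3 : G.dist (d.z a) (d.z (b + 1)) ≤ G.dist (d.z a) (d.z b) + G.dist (d.z b) (d.z (b + 1)) :=
      hG.dist_triangle
    omega

lemma dist_rho (hG : G.Connected) {a b : ℕ} (ha : a < d.k) (hb : b < d.k) :
    G.dist (d.z a) (d.z b) ≤ rho d.k a b := by
  unfold rho
  split_ifs with h
  · exact d.dist_up hG h hb
  · have h1 := d.dist_up hG (a := a) (b := d.k - 1) (by omega) (by omega)
    have h2 := d.dist_up hG (a := 0) (b := b) (by omega) (by omega)
    have h3 : G.dist (d.z (d.k - 1)) (d.z 0) = 1 := dist_eq_one_iff_adj.2 d.adj0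
    have h4 : G.dist (d.z a) (d.z b) ≤ G.dist (d.z a) (d.z (d.k - 1)) +
      G.dist (d.z (d.k - 1)) (d.z b) := hG.dist_triangle
    have h5 : G.dist (d.z (d.k - 1)) (d.z b) ≤ G.dist (d.z (d.k - 1)) (d.z 0) +
      G.dist (d.z 0) (d.z b) := hG.dist_triangle
    omega

lemma fe_left (i : ℕ) : d.z i ∈ d.fe i := by simp [fe]
lemma fe_right (i : ℕ) : d.z (d.nx i) ∈ d.fe i := by simp [fe]

lemma core_core (hG : G.Connected) :
    ∑ i ∈ range d.k, ∑ j ∈ range d.k, eDist G (d.fe i) (d.fe j) ≤ d.k * DD d.k := by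
  have h : ∀ i ∈ range d.k, ∑ j ∈ range d.k, eDist G (d.fe i) (d.fe j) ≤ DD d.k := by
    intro i hi
    rw [Finset.mem_range] at hi
    unfold DD
    rw [← sum_rho_right d.k i hi (fun s => min s (d.k - s))]
    refine Finset.sum_le_sum fun j hj => ?_
    rw [Finset.mem_range] at hj
    beta_reduce
    by_cases hij : i = j
    · subst hij; rw [eDist_self]; omega
    · have h1 := (eDist_le G (d.fe_right i) (d.fe_left j)).trans
        (Nat.add_le_add_right (d.dist_rho hG (d.nx_lt hi) hj) 1)
      have h2 := (eDist_le G (d.fe_right j) (d.fe_left i)).trans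
        (Nat.add_le_add_right (d.dist_rho hG (d.nx_lt hj) hi) 1)
      rw [eDist_comm] at h2
      unfold rho nx at *
      split_ifs at * <;> omega
  refine (Finset.sum_le_sum h).trans ?_
  simp

lemma branch_core (hG : G.Connected) {a : ℕ} (ha : a < d.k) :
    ∑ i ∈ range d.k, vDist G (d.z a) (d.fe i) ≤ DD (d.k - 1) := by
  have hk := d.hk
  rw [← DD_succ, Nat.sub_add_cancel (by omega),
    ← sum_rho_right d.k a ha (fun s => min s (d.k - 1 - s))]
  refine Finset.sum_le_sum fun j hj => ?_
  rw [Finset.mem_range] at hj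
  beta_reduce
  have h1 := (vDist_le G (v := d.z a) (d.fe_left j)).trans (d.dist_rho hG ha hj)
  have h2 := vDist_le G (v := d.z a) (d.fe_right j)
  have h3 := d.dist_rho hG (d.nx_lt hj) ha
  rw [dist_comm] at h3
  unfold rho nx at *
  split_ifs at * <;> omega

end Cyc

end S16


namespace S16
namespace Cyc

variable {V : Type} {G : SimpleGraph V} (d : Cyc G)

/-- index adjacency of the lollipop (oriented) -/
def R (k i j : ℕ) : Prop := j = i + 1 ∨ (i + 3 = k ∧ j + 1 = k)

/-- the lollipop: a path with a triangle at its end -/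
def lol : SimpleGraph V where
  Adj x y := x ∈ d.K ∧ y ∈ d.K ∧ (R d.k (d.idx x) (d.idx y) ∨ R d.k (d.idx y) (d.idx x))
  symm := ⟨fun x y h => ⟨h.2.1, h.1, h.2.2.symm⟩⟩
  loopless := ⟨by
    rintro x ⟨-, -, h⟩
    unfold R at h
    omega⟩

/-- edges of the lollipop -/
def ge (i : ℕ) : Sym2 V :=
  if i + 1 < d.k then s(d.z i, d.z (i + 1)) else s(d.z (d.k - 3), d.z (d.k - 1))

lemma lol_adj {i j : ℕ} (hi : i < d.k) (hj : j < d.k) (h : R d.k i j) :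
    d.lol.Adj (d.z i) (d.z j) :=
  ⟨d.z_mem i hi, d.z_mem j hj, Or.inl (by rwa [d.idx_z i hi, d.idx_z j hj])⟩

lemma ge_inj : Set.InjOn d.ge (range d.k : Finset ℕ) := by
  intro i hi j hj h
  simp only [Finset.coe_range, Set.mem_Iio] at hi hj
  have hk := d.hk
  unfold ge at h
  split_ifs at h with h1 h2 h2
  · rcases Sym2.eq_iff.1 h with ⟨e1, e2⟩ | ⟨e1, e2⟩
    · exact d.z_inj hi hj e1
    · have := d.z_inj hi h2 e1
      have := d.z_inj h1 hj e2
      omega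
  · rcases Sym2.eq_iff.1 h with ⟨e1, e2⟩ | ⟨e1, e2⟩
    · have := d.z_inj hi (by omega) e1
      have := d.z_inj h1 (by omega) e2
      omega
    · have := d.z_inj hi (by omega) e1
      have := d.z_inj h1 (by omega) e2
      omega
  · rcases Sym2.eq_iff.1 h with ⟨e1, e2⟩ | ⟨e1, e2⟩
    · have := d.z_inj (by omega) hj e1
      have := d.z_inj (by omega) h2 e2
      omega
    · have := d.z_inj (by omega) h2 e1
      have := d.z_inj (by omega) hj e2
      omega
  · omega

lemma R_ge {i j : ℕ} (hj : j < d.k) (h : R d.k i j) :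
    s(d.z i, d.z j) = d.ge (if j = i + 1 then i else d.k - 1) := by
  unfold ge
  have hk := d.hk
  rcases h with h | ⟨h1, h2⟩
  · subst h
    rw [if_pos rfl, if_pos hj]
  · have h3 : j ≠ i + 1 := by omega
    rw [if_neg h3, if_neg (by omega), show d.k - 3 = i by omega, show d.k - 1 = j by omega]

lemma lol_edge {e : Sym2 V} : e ∈ d.lol.edgeSet ↔ ∃ i < d.k, d.ge i = e := by
  have hk := d.hk
  induction e using Sym2.ind with
  | _ x y =>
    rw [mem_edgeSet]
    constructor
    · rintro ⟨hx, hy, h⟩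
      have e1 := d.z_idx x hx
      have e2 := d.z_idx y hy
      have l1 := d.idx_lt x hx
      have l2 := d.idx_lt y hy
      rcases h with h | h
      · refine ⟨_, ?_, (d.R_ge l2 h).symm.trans (by rw [e1, e2])⟩
        split_ifs <;> omega
      · refine ⟨_, ?_, (d.R_ge l1 h).symm.trans (by rw [e1, e2, Sym2.eq_swap])⟩
        split_ifs <;> omega
    · rintro ⟨i, hi, h⟩
      rw [← mem_edgeSet, ← h]
      unfold ge
      split_ifs with h1
      · exact d.lol_adj hi h1 (Or.inl rfl)
      · exact d.lol_adj (by omega) (by omega) (Or.inr (by omega))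

lemma lol_edgeFinset [Fintype V] : d.lol.edgeFinset = (range d.k).image d.ge := by
  ext e
  rw [mem_edgeFinset, lol_edge]
  simp

lemma lol_conn {x y : V} (hx : x ∈ d.K) (hy : y ∈ d.K) : d.lol.Reachable x y := by
  have hk := d.hk
  have h : ∀ i < d.k, d.lol.Reachable (d.z 0) (d.z i) := by
    intro i
    induction i with
    | zero => intro _; exact Reachable.refl _
    | succ i ih =>
      intro hi
      exact (ih (by omega)).trans (d.lol_adj (by omega) hi (Or.inl rfl)).reachable
  have h1 := h _ (d.idx_lt x hx)
  have h2 := h _ (d.idx_lt y hy)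
  rw [d.z_idx _ hx] at h1
  rw [d.z_idx _ hy] at h2
  exact h1.symm.trans h2

lemma lol_cycle {u : V} {c : d.lol.Walk u u} (hc : c.IsCycle) :
    c.edges.toFinset = ({d.ge (d.k - 3), d.ge (d.k - 2), d.ge (d.k - 1)} : Finset (Sym2 V)) := by
  have hk := d.hk
  have hK : ∀ x ∈ c.support, x ∈ d.K := by
    intro x hx
    obtain ⟨s, hs, -⟩ := cyc_rest hc hx
    exact hs.1
  obtain ⟨x, hx, hmin⟩ := Finset.exists_min_image c.support.toFinset d.idx
    ⟨u, by simp⟩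
  rw [List.mem_toFinset] at hx
  have hge : d.k - 3 ≤ d.idx x := by
    by_contra hlt
    have hc' := hc.rotate hx
    have hsup : ∀ q, q ∈ (c.rotate x hx).support → q ∈ c.support :=
      fun q => (c.mem_support_rotate_iff x hx).1
    set c' := c.rotate x hx
    have key : ∀ y, d.lol.Adj x y → y ∈ c'.support → y = d.z (d.idx x + 1) := by
      intro y hy hyc
      have h1 := hmin y (by simpa using hsup y hyc)
      obtain ⟨hxK, hyK, h⟩ := hy
      unfold R at h
      have : d.idx y = d.idx x + 1 := by omega
      rw [← this, d.z_idx y hyK]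
    refine hc'.snd_ne_penultimate ((key _ (c'.adj_snd hc'.not_nil) ?_).trans
      (key _ (c'.adj_penultimate hc'.not_nil).symm ?_).symm)
    · exact c'.getVert_mem_support _
    · exact c'.getVert_mem_support _
  refine Finset.eq_of_subset_of_card_le ?_ ?_
  · intro e he
    rw [List.mem_toFinset] at he
    obtain ⟨i, hi, rfl⟩ := d.lol_edge.1 (c.edges_subset_edgeSet he)
    have hi3 : d.k - 3 ≤ i := by
      by_cases h1 : i + 1 < d.k
      · have h2 : d.ge i = s(d.z i, d.z (i + 1)) := if_pos h1
        rw [h2] at he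
        have h3 := hmin _ (by simpa using c.fst_mem_support_of_mem_edges he)
        rw [d.idx_z i hi] at h3
        omega
      · omega
    simp only [Finset.mem_insert, Finset.mem_singleton]
    have : i = d.k - 3 ∨ i = d.k - 2 ∨ i = d.k - 1 := by omega
    rcases this with h | h | h <;> simp [h]
  · rw [List.toFinset_card_of_nodup hc.edges_nodup, Walk.length_edges]
    exact Finset.card_le_three.trans hc.three_le_length

lemma lol_cac : Cac d.lol := by
  intro u w c1 c2 h1 h2 hne
  exact absurd ((d.lol_cycle h1).trans (d.lol_cycle h2).symm) hne

/-- attachment points -/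
noncomputable def atp (s : ℕ) (x : V) : V :=
  if rho d.k s (d.idx x) < d.k / 2 then d.z (d.k - 2) else d.z 0

/-- the lollipop surgery -/
noncomputable def lolS (s : ℕ) : Surg G where
  K := d.K
  pr := d.pr
  at_ := d.atp s
  K' := d.lol
  pr_mem := d.pr_mem
  pr_id := d.pr_id
  adj_out := d.adj_out
  at_mem x _ := by
    have hk := d.hk
    unfold atp
    split_ifs
    · exact d.z_mem _ (by omega)
    · exact d.z_mem _ (by omega)
  K'_sub x y h := h.1
  K'_conn x hx y hy := d.lol_conn hx hy
  K'_cac := d.lol_cac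

/-- level of a vertex in the new graph -/
noncomputable def lev (s : ℕ) (x : V) : ℕ :=
  min (d.idx (if x ∈ d.K then x else d.atp s (d.pr x))) (d.k - 2)

lemma lev_z (s : ℕ) {i : ℕ} (hi : i < d.k) : d.lev s (d.z i) = min i (d.k - 2) := by
  unfold lev
  rw [if_pos (d.z_mem i hi), d.idx_z i hi]

lemma lev_lip (s : ℕ) (x y : V) (h : (d.lolS s).H.Adj x y) : d.lev s x ≤ d.lev s y + 1 := by
  have hout : ∀ x y, (d.lolS s).H.Adj x y → x ∉ d.K → d.lev s x = d.lev s y := by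
    intro x y h hx
    obtain ⟨b, hb, rfl⟩ := (d.lolS s).H_adj_out h hx
    have hpr := d.adj_out x b hb hx
    unfold lev
    rw [if_neg hx, hpr]
    by_cases hbK : b ∈ d.K
    · rw [(d.lolS s).tau_mem hbK, if_pos (show (d.lolS s).at_ b ∈ d.K from (d.lolS s).at_mem b hbK), d.pr_id b hbK]
      rfl
    · rw [(d.lolS s).tau_not hbK, if_neg hbK]
  by_cases hx : x ∈ d.K
  · by_cases hy : y ∈ d.K
    · obtain ⟨-, -, h1⟩ := (d.lolS s).H_adj_core h hx hy
      unfold lev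
      rw [if_pos hx, if_pos hy]
      unfold R at h1
      omega
    · rw [hout y x h.symm hy]; omega
  · rw [hout x y h hx]; omega

lemma lev_dist (hG : G.Connected) (s : ℕ) (x y : V) :
    d.lev s x ≤ d.lev s y + (d.lolS s).H.dist x y :=
  lip_dist ((d.lolS s).conn hG) (d.lev s) (d.lev_lip s) x y

lemma ge_lev (s : ℕ) {i : ℕ} (hi : i < d.k) {x : V} (hx : x ∈ d.ge i) :
    al d.k i ≤ d.lev s x ∧ d.lev s x ≤ al d.k i + 1 := by
  have hk := d.hk
  unfold ge at hx
  unfold al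
  split_ifs at hx with h1
  · rw [if_neg (by omega)]
    rcases Sym2.mem_iff.1 hx with rfl | rfl
    · rw [d.lev_z s hi]; omega
    · rw [d.lev_z s h1]; omega
  · rw [if_pos (by omega)]
    rcases Sym2.mem_iff.1 hx with rfl | rfl
    · rw [d.lev_z s (by omega)]; omega
    · rw [d.lev_z s (by omega)]; omega

lemma H_core (hG : G.Connected) (s : ℕ) (hk : 4 ≤ d.k) :
    d.k * DD d.k ≤
      ∑ i ∈ range d.k, ∑ j ∈ range d.k, eDist (d.lolS s).H (d.ge i) (d.ge j) + 2 := by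
  refine (sum_lam d.k hk).trans (Nat.add_le_add_right ?_ 2)
  refine Finset.sum_le_sum fun i hi => Finset.sum_le_sum fun j hj => ?_
  unfold lam
  split_ifs with hij
  · omega
  · have hne : d.ge i ≠ d.ge j := fun h => hij (d.ge_inj hi hj h)
    rw [Finset.mem_range] at hi hj
    have := le_eDist (d.lolS s).H (n := ad (al d.k i) (al d.k j) - 1) hne (by
      intro u hu w hw
      have h1 := d.ge_lev s hi hu
      have h2 := d.ge_lev s hj hw
      have h3 := d.lev_dist hG s u w
      have h4 := d.lev_dist hG s w u
      rw [dist_comm] at h4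
      unfold ad
      omega)
    omega

lemma sum_al (k : ℕ) (hk : 4 ≤ k) : DD (k - 1) + 1 ≤ ∑ i ∈ range k, al k i := by
  obtain ⟨n, rfl⟩ : ∃ n, k = n + 1 := ⟨k - 1, by omega⟩
  have h1 := DD_le n
  rw [Finset.sum_range_succ]
  have h2 : ∑ i ∈ range n, al (n + 1) i = ∑ i ∈ range n, i := by
    refine Finset.sum_congr rfl fun i hi => ?_
    rw [Finset.mem_range] at hi
    unfold al; rw [if_neg (by omega)]
  have h3 : al (n + 1) n = n - 2 := by unfold al; simp
  rw [h2, h3]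
  have h4 := Finset.sum_range_id_mul_two n
  simp only [Nat.add_sub_cancel]
  obtain ⟨m, rfl⟩ : ∃ m, n = m + 3 := ⟨n - 3, by omega⟩
  simp only [show m + 3 - 1 = m + 2 by omega, show m + 3 - 2 = m + 1 by omega] at *
  nlinarith

lemma H_p (hG : G.Connected) (s : ℕ) (hk : 4 ≤ d.k) :
    DD (d.k - 1) + 1 ≤ ∑ i ∈ range d.k, vDist (d.lolS s).H (d.z 0) (d.ge i) := by
  refine (sum_al d.k hk).trans (Finset.sum_le_sum fun i hi => ?_)
  rw [Finset.mem_range] at hi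
  obtain ⟨w, hw, h⟩ := vDist_exists (d.lolS s).H (d.z 0) (d.ge i)
  rw [h]
  have h1 := d.ge_lev s hi hw
  have h2 := d.lev_dist hG s w (d.z 0)
  rw [dist_comm, d.lev_z s (by omega)] at h2
  omega

lemma sum_q (k : ℕ) (hk : 4 ≤ k) :
    DD (k - 1) ≤ ∑ i ∈ range k, (if i = k - 1 then 1 else k - 3 - i) := by
  obtain ⟨n, rfl⟩ : ∃ n, k = n + 3 := ⟨k - 3, by omega⟩
  have h1 := DD_le (n + 2)
  rw [Finset.sum_range_succ, Finset.sum_range_succ, Finset.sum_range_succ]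
  have h2 : ∑ i ∈ range n, (if i = n + 3 - 1 then 1 else n + 3 - 3 - i) =
      ∑ i ∈ range n, (n - i) := by
    refine Finset.sum_congr rfl fun i hi => ?_
    rw [Finset.mem_range] at hi
    rw [if_neg (by omega)]
    omega
  have h3 := sum_sub_range n
  rw [h2]
  simp
  obtain ⟨m, rfl⟩ : ∃ m, n = m + 1 := ⟨n - 1, by omega⟩
  rcases Nat.eq_zero_or_pos m with rfl | hm
  · omega
  · nlinarith

lemma H_q (hG : G.Connected) (s : ℕ) (hk : 4 ≤ d.k) :
    DD (d.k - 1) ≤ ∑ i ∈ range d.k, vDist (d.lolS s).H (d.z (d.k - 2)) (d.ge i) := by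
  refine (sum_q d.k hk).trans (Finset.sum_le_sum fun i hi => ?_)
  rw [Finset.mem_range] at hi
  obtain ⟨w, hw, h⟩ := vDist_exists (d.lolS s).H (d.z (d.k - 2)) (d.ge i)
  rw [h]
  split_ifs with hik
  · refine ((d.lolS s).conn hG).pos_dist_of_ne ?_
    rintro rfl
    unfold ge at hw
    rw [if_neg (by omega)] at hw
    rcases Sym2.mem_iff.1 hw with h1 | h1
    · have := d.z_inj (by omega) (by omega) h1
      omega
    · have := d.z_inj (by omega) (by omega) h1
      omega
  · have h1 := d.ge_lev s hi hw
    have h2 := d.lev_dist hG s (d.z (d.k - 2)) w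
    rw [d.lev_z s (by omega)] at h2
    unfold al at h1
    rw [if_neg hik] at h1
    omega

theorem lol_W2 [Fintype V] (hG : IsCactus G) (hk : 4 ≤ d.k) {p1 p2 : V} (hp1 : p1 ∈ d.K)
    (hp2 : p2 ∈ d.K) (h12 : p1 ≠ p2) (hb1 : ∃ y, y ∉ d.K ∧ d.pr y = p1)
    (hb2 : ∃ y, y ∉ d.K ∧ d.pr y = p2) :
    ∃ s, (d.lolS s).K'.edgeFinset.card = (d.lolS s).C.card ∧
      Surg.W2 G ≤ Surg.W2 (d.lolS s).H := by
  have hconn := hG.1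
  set N := (d.lolS 0).N with hN
  set rt := (d.lolS 0).rt with hrt
  have hrtK : ∀ e, rt e ∈ d.K := fun e => d.pr_mem _
  obtain ⟨s, hs⟩ := exists_cut d.k (by omega) N (fun e => d.idx (rt e))
    (fun e _ => d.idx_lt _ (hrtK e)) (fun e f => G.dist (rt e) (rt f)) (by
      intro e _ f _
      have h1 := d.dist_rho hconn (d.idx_lt _ (hrtK e)) (d.idx_lt _ (hrtK f))
      have h2 := d.dist_rho hconn (d.idx_lt _ (hrtK f)) (d.idx_lt _ (hrtK e))
      rw [d.z_idx _ (hrtK e), d.z_idx _ (hrtK f)] at h1 h2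
      rw [dist_comm] at h2
      exact le_min h1 h2)
  refine ⟨s, ?_⟩
  have hC : (d.lolS s).C = (range d.k).image d.fe := by
    rw [← d.core_eq]; ext e; simp only [Surg.C, Finset.mem_filter]; exact Iff.rfl
  have hK' : (d.lolS s).K'.edgeFinset = (range d.k).image d.ge := by
    rw [← d.lol_edgeFinset]; ext e; simp only [mem_edgeFinset]; exact Iff.rfl
  have hcard : (d.lolS s).K'.edgeFinset.card = (d.lolS s).C.card := by
    rw [hC, hK', Finset.card_image_of_injOn d.fe_inj, Finset.card_image_of_injOn d.ge_inj]
  refine ⟨hcard, ?_⟩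
  have hmain := (d.lolS s).main hconn hcard
  rw [hC, hK'] at hmain
  simp only [Finset.sum_image d.fe_inj, Finset.sum_image d.ge_inj] at hmain
  change Surg.W2 G + _ + 2 * ∑ e ∈ N, ∑ i ∈ range d.k, vDist (d.lolS s).H (d.atp s (rt e)) (d.ge i) +
    ∑ e ∈ N, ∑ f ∈ N, (d.lolS s).H.dist (d.atp s (rt e)) (d.atp s (rt f)) ≤ 
    Surg.W2 (d.lolS s).H + _ + 2 * ∑ e ∈ N, ∑ i ∈ range d.k, vDist G (rt e) (d.fe i) +
    ∑ e ∈ N, ∑ f ∈ N, G.dist (rt e) (rt f) at hmain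
  have c1 := d.core_core hconn
  have c2 := d.H_core hconn s hk
  set P : Sym2 V → Prop := fun e => rho d.k s (d.idx (rt e)) < d.k / 2 with hP
  set w := (N.filter P).card with hw
  set wc := (N.filter (fun e => ¬ P e)).card with hwc
  have b1 : ∑ e ∈ N, ∑ f ∈ N, G.dist (rt e) (rt f) ≤ d.k * (w * wc) := by
    convert hs
  have hbr : ∀ p ∈ d.K, (∃ y, y ∉ d.K ∧ d.pr y = p) → ∃ e ∈ N, rt e = p := by
    intro p hp ⟨y, hy⟩
    obtain ⟨x, hx, hxp⟩ := ((d.lolS 0).closed_G hp).exists_adj hconn ⟨y, hy⟩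
    have hmem : s(x, p) ∈ N := by
      refine Finset.mem_filter.2 ⟨by simpa using hxp, fun h => hx.1 (h x (by simp))⟩
    exact ⟨s(x, p), hmem, ((d.lolS 0).pr_rt hmem (Sym2.mem_mk_left x p)).symm.trans hx.2⟩
  have hwc1 : 1 ≤ wc := by
    obtain ⟨e, he, hre⟩ := hbr p1 hp1 hb1
    obtain ⟨f, hf, hrf⟩ := hbr p2 hp2 hb2
    have h1 : 0 < G.dist (rt e) (rt f) := hconn.pos_dist_of_ne (by rwa [hre, hrf])
    have h2 := Finset.single_le_sum (f := fun f => G.dist (rt e) (rt f)) (fun _ _ => Nat.zero_le _) hf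
    have h3 := Finset.single_le_sum (f := fun e => ∑ f ∈ N, G.dist (rt e) (rt f))
      (fun _ _ => Nat.zero_le _) he
    beta_reduce at h2 h3
    rcases Nat.eq_zero_or_pos wc with h | h
    · rw [h] at b1; omega
    · exact h
  have b2 : 2 * (d.k - 2) * (w * wc) ≤
      ∑ e ∈ N, ∑ f ∈ N, (d.lolS s).H.dist (d.atp s (rt e)) (d.atp s (rt f)) := by
    have h0 : 2 * (d.k - 2) * (w * wc) =
        ∑ e ∈ N, ∑ f ∈ N, (if ¬ (P e ↔ P f) then d.k - 2 else 0) := by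
      rw [hw, hwc]
      convert (sep_sum N P (d.k - 2)).symm
    rw [h0]
    refine Finset.sum_le_sum fun e _ => Finset.sum_le_sum fun f _ => ?_
    have hpq := d.lev_dist hconn s (d.z (d.k - 2)) (d.z 0)
    rw [d.lev_z s (by omega), d.lev_z s (by omega)] at hpq
    have hqp := dist_comm (G := (d.lolS s).H) (u := d.z (d.k - 2)) (v := d.z 0)
    unfold atp
    simp only [hP]
    split_ifs <;> first | omega | tauto
  have b3 : d.k * (w * wc) ≤ 2 * (d.k - 2) * (w * wc) := Nat.mul_le_mul_right _ (by omega)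
  have a1 : ∑ e ∈ N, ∑ i ∈ range d.k, vDist G (rt e) (d.fe i) + wc ≤
      ∑ e ∈ N, ∑ i ∈ range d.k, vDist (d.lolS s).H (d.atp s (rt e)) (d.ge i) := by
    rw [hwc, Finset.card_filter, ← Finset.sum_add_distrib]
    refine Finset.sum_le_sum fun e _ => ?_
    have h1 := d.branch_core hconn (d.idx_lt _ (hrtK e))
    rw [d.z_idx _ (hrtK e)] at h1
    have h2 := d.H_p hconn s hk
    have h3 := d.H_q hconn s hk
    unfold atp
    simp only [hP]
    split_ifs <;> omega
  omega

end Cyc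

/-- an optimal cactus has at most two positions with branches on a long cycle -/
theorem Opt.lol {V : Type} [Fintype V] {G : SimpleGraph V} (hG : Opt G) (d : Cyc G) (hk : 4 ≤ d.k)
    {p1 p2 p3 : V} (hp1 : p1 ∈ d.K) (hp2 : p2 ∈ d.K) (hp3 : p3 ∈ d.K) (h12 : p1 ≠ p2)
    (h13 : p1 ≠ p3) (h23 : p2 ≠ p3)
    (hb1 : ∃ y, y ∉ d.K ∧ d.pr y = p1) (hb2 : ∃ y, y ∉ d.K ∧ d.pr y = p2)
    (hb3 : ∃ y, y ∉ d.K ∧ d.pr y = p3) : False := by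
  obtain ⟨s, hcard, hW⟩ := d.lol_W2 hG.1 hk hp1 hp2 h12 hb1 hb2
  set S := d.lolS s with hS
  have hce := S.card_eq hcard
  have hopt : Opt S.H := by
    refine ⟨S.isCactus hG.1, fun H hH hc => ?_⟩
    have := hG.2 H hH (hc.trans hce)
    omega
  have key : ∀ a b c : V, a ∈ d.K → b ∈ d.K → a ≠ b → a ≠ c → b ≠ c →
      (∃ y, y ∉ d.K ∧ d.pr y = a) → (∃ y, y ∉ d.K ∧ d.pr y = b) →
      (∃ y, y ∉ d.K ∧ d.pr y = c) → d.atp s a ≠ d.atp s b := by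
    intro a b c ha hb hab hac hbc hya hyb hyc he
    have hcA : Closed S.H (S.S a) (d.atp s a) := S.closed_H ha
    have hcB : Closed S.H (S.S b) (d.atp s a) := by rw [he]; exact S.closed_H hb
    have hdisj : ∀ a b : V, a ≠ b → Disjoint (S.S a) (S.S b) := by
      intro a b hab
      rw [Set.disjoint_left]
      rintro y ⟨-, h1⟩ ⟨-, h2⟩
      exact hab (h1.symm.trans h2)
    have hcC : Closed S.H {y | y ∉ S.S a ∧ y ∉ S.S b ∧ y ≠ d.atp s a} (d.atp s a) := by
      refine ⟨fun h => h.2.2 rfl, fun x y hxy hx hy => ?_⟩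
      by_contra hne
      have : y ∈ S.S a ∨ y ∈ S.S b := by
        by_contra h
        push Not at h
        exact hy ⟨h.1, h.2, hne⟩
      rcases this with h | h
      · exact hx.2.2 (hcA.2 y x hxy.symm h hx.1)
      · exact hx.2.2 (hcB.2 y x hxy.symm h hx.2.1)
    refine hopt.triple hcA hcB hcC hya hyb ?_ (hdisj a b hab) ?_ ?_
    · obtain ⟨y, hy, hyc⟩ := hyc
      refine ⟨y, fun h => hac (h.2.symm.trans hyc), fun h => hbc (h.2.symm.trans hyc), ?_⟩
      rintro rfl
      exact hy (S.at_mem a ha)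
    · rw [Set.disjoint_left]
      exact fun y h1 h2 => h2.1 h1
    · rw [Set.disjoint_left]
      exact fun y h1 h2 => h2.2.1 h1
  have k1 := key p1 p2 p3 hp1 hp2 h12 h13 h23 hb1 hb2 hb3
  have k2 := key p1 p3 p2 hp1 hp3 h13 h12 h23.symm hb1 hb3 hb2
  have k3 := key p2 p3 p1 hp2 hp3 h23 h12.symm h13.symm hb2 hb3 hb1
  unfold Cyc.atp at k1 k2 k3
  split_ifs at k1 k2 k3 <;> simp_all

end S16


namespace S16

/-- vertices reachable from `x` avoiding `v` -/
def Comp {V : Type} (G : SimpleGraph V) (v x : V) : Set V :=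
  {y | ∃ w : G.Walk x y, v ∉ w.support}

lemma comp_self {V : Type} {G : SimpleGraph V} {v x : V} (h : x ≠ v) : x ∈ Comp G v x :=
  ⟨Walk.nil, by simpa using h.symm⟩

lemma comp_symm {V : Type} {G : SimpleGraph V} {v x y : V} (h : y ∈ Comp G v x) :
    x ∈ Comp G v y := by
  obtain ⟨w, hw⟩ := h
  exact ⟨w.reverse, by simpa using hw⟩

lemma comp_trans {V : Type} {G : SimpleGraph V} {v x y z : V} (h : y ∈ Comp G v x)
    (h' : z ∈ Comp G v y) : z ∈ Comp G v x := by
  obtain ⟨w, hw⟩ := h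
  obtain ⟨w', hw'⟩ := h'
  exact ⟨w.append w', by rw [Walk.mem_support_append_iff]; tauto⟩

lemma comp_closed {V : Type} {G : SimpleGraph V} (v x : V) : Closed G (Comp G v x) v := by
  refine ⟨fun ⟨w, hw⟩ => hw (by simp), fun a b hab ha hb => ?_⟩
  by_contra hbv
  refine hb (comp_trans ha ⟨Walk.cons hab Walk.nil, ?_⟩)
  have : v ≠ a := by
    rintro rfl
    obtain ⟨w, hw⟩ := ha
    exact hw (by simp)
  simp [this, Ne.symm hbv]

lemma comp_disjoint {V : Type} {G : SimpleGraph V} {v x y : V} (h : y ∉ Comp G v x) :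
    Disjoint (Comp G v x) (Comp G v y) := by
  rw [Set.disjoint_left]
  intro z hz hz'
  exact h (comp_trans hz (comp_symm hz'))

lemma cut_exists {V : Type} [Fintype V] {G : SimpleGraph V} {v : V}
    (hV : 2 ≤ Fintype.card V) (h : IsCutVertex G v) :
    ∃ a b, a ≠ v ∧ b ≠ v ∧ b ∉ Comp G v a := by
  by_contra hcon
  push Not at hcon
  apply h
  obtain ⟨a, ha⟩ := Fintype.exists_ne_of_one_lt_card (by omega) v
  haveI : Nonempty {u | u ≠ v} := ⟨⟨a, ha⟩⟩
  refine ⟨fun x y => ?_⟩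
  obtain ⟨w, hw⟩ := hcon x.1 y.1 x.2 y.2
  exact ⟨w.induce {u | u ≠ v} (fun z hz => by rintro rfl; exact hw hz)⟩

lemma sameBlock_symm {V : Type} {G : SimpleGraph V} {e f : Sym2 V} (h : SameBlock G e f) :
    SameBlock G f e := by
  rcases h with rfl | ⟨v, c, hc, h1, h2⟩
  · exact Or.inl rfl
  · exact Or.inr ⟨v, c, hc, h2, h1⟩

lemma same_edges {V : Type} {G : SimpleGraph V} (hG : Cac G) {e : Sym2 V} {u w : V}
    {c1 : G.Walk u u} {c2 : G.Walk w w} (h1 : c1.IsCycle) (h2 : c2.IsCycle)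
    (he1 : e ∈ c1.edges) (he2 : e ∈ c2.edges) (f : Sym2 V) : f ∈ c1.edges ↔ f ∈ c2.edges := by
  induction e using Sym2.ind with
  | _ x y =>
    have hxy : G.Adj x y := c1.adj_of_mem_edges he1
    exact hG.edges_eq h1 h2 hxy.ne (Walk.fst_mem_support_of_mem_edges _ he1)
      (Walk.fst_mem_support_of_mem_edges _ he2) (Walk.snd_mem_support_of_mem_edges _ he1)
      (Walk.snd_mem_support_of_mem_edges _ he2) f

lemma sameBlock_trans {V : Type} {G : SimpleGraph V} (hG : Cac G) {e f g : Sym2 V}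
    (h : SameBlock G e f) (h' : SameBlock G f g) : SameBlock G e g := by
  rcases h with rfl | ⟨v, c, hc, h1, h2⟩
  · exact h'
  · rcases h' with rfl | ⟨v', c', hc', h1', h2'⟩
    · exact Or.inr ⟨v, c, hc, h1, h2⟩
    · exact Or.inr ⟨v, c, hc, h1, (same_edges hG hc hc' h2 h1' g).2 h2'⟩

theorem cut_blocks {V : Type} [Fintype V] {G : SimpleGraph V} (hG : Opt G)
    (hV : 2 ≤ Fintype.card V) {v : V} (hv : IsCutVertex G v) :
    {B : Set (Sym2 V) | IsBlockEdges G B ∧ ∃ e ∈ B, v ∈ e}.ncard = 2 := by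
  have hC : Cac G := hG.1.2
  obtain ⟨a0, b0, ha0, hb0, hab⟩ := cut_exists hV hv
  have hAc := comp_closed (G := G) v a0
  have hBc := comp_closed (G := G) v b0
  have hD := comp_disjoint hab
  have hcov : ∀ y, y ≠ v → y ∈ Comp G v a0 ∨ y ∈ Comp G v b0 := by
    intro y hy
    by_contra hcon
    push Not at hcon
    exact hG.triple hAc hBc (comp_closed v y) ⟨_, comp_self ha0⟩ ⟨_, comp_self hb0⟩
      ⟨_, comp_self hy⟩ hD (comp_disjoint hcon.1) (comp_disjoint hcon.2)
  obtain ⟨a, haA, hav⟩ := hAc.exists_adj hG.1.1 ⟨_, comp_self ha0⟩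
  obtain ⟨b, hbB, hbv⟩ := hBc.exists_adj hG.1.1 ⟨_, comp_self hb0⟩
  have hsame : ∀ x, ∀ y ∈ Comp G v x, ∀ z ∈ Comp G v x, G.Adj y v → G.Adj z v →
      SameBlock G s(v, y) s(v, z) := by
    intro x y hy z hz hyv hzv
    by_cases hyz : y = z
    · subst hyz; exact Or.inl rfl
    · obtain ⟨w, hw⟩ := comp_trans (comp_symm hy) hz
      obtain ⟨c, hc, h1, h2⟩ := cyc_exists hyv.symm hzv.symm hyz w hw
      exact Or.inr ⟨v, c, hc, h1, h2⟩
  have hnot : ¬ SameBlock G s(v, a) s(v, b) := by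
    intro h
    have hba : b ∉ Comp G v a0 := fun h => Set.disjoint_left.1 hD h hbB
    rcases h with h | ⟨u, c, hc, h1, h2⟩
    · rw [Sym2.congr_right] at h
      exact hba (h ▸ haA)
    · rcases hAc.cycle c hc (Walk.snd_mem_support_of_mem_edges _ h1) haA
        (Walk.snd_mem_support_of_mem_edges _ h2) with h | h
      · exact hba h
      · exact hbv.ne h
  have hset : {B : Set (Sym2 V) | IsBlockEdges G B ∧ ∃ e ∈ B, v ∈ e} =
      {{f ∈ G.edgeSet | SameBlock G s(v, a) f}, {f ∈ G.edgeSet | SameBlock G s(v, b) f}} := by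
    have hcl : ∀ e f, SameBlock G e f →
        {g ∈ G.edgeSet | SameBlock G e g} = {g ∈ G.edgeSet | SameBlock G f g} := by
      intro e f hef
      ext g
      constructor
      · rintro ⟨h1, h2⟩; exact ⟨h1, sameBlock_trans hC (sameBlock_symm hef) h2⟩
      · rintro ⟨h1, h2⟩; exact ⟨h1, sameBlock_trans hC hef h2⟩
    ext B
    constructor
    · rintro ⟨⟨e, he, rfl⟩, f, ⟨hf, hef⟩, hvf⟩
      rw [hcl _ _ hef]
      obtain ⟨y, rfl⟩ := Sym2.mem_iff_exists.1 hvf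
      have hvy : G.Adj v y := hf
      rcases hcov y hvy.ne' with hy | hy
      · left; exact hcl _ _ (hsame _ _ hy _ haA hvy.symm hav)
      · right; exact hcl _ _ (hsame _ _ hy _ hbB hvy.symm hbv)
    · rintro (rfl | rfl)
      · exact ⟨⟨s(v, a), hav.symm, rfl⟩, s(v, a), ⟨hav.symm, Or.inl rfl⟩, by simp⟩
      · exact ⟨⟨s(v, b), hbv.symm, rfl⟩, s(v, b), ⟨hbv.symm, Or.inl rfl⟩, by simp⟩
  rw [hset]
  apply Set.ncard_pair
  intro h
  have : s(v, b) ∈ {f ∈ G.edgeSet | SameBlock G s(v, a) f} := by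
    rw [h]; exact ⟨hbv.symm, Or.inl rfl⟩
  exact hnot this.2

lemma cut_branch {V : Type} [Fintype V] {G : SimpleGraph V} (hG : Opt G)
    (hV : 2 ≤ Fintype.card V) {u : V} {c : G.Walk u u} (hc : c.IsCycle) (d : Cyc G)
    (hd : d.K = {x | x ∈ c.support}) {p : V} (hp : p ∈ d.K) (hcut : IsCutVertex G p) :
    ∃ y, y ∉ d.K ∧ d.pr y = p := by
  obtain ⟨a0, b0, ha0, hb0, hab⟩ := cut_exists hV hcut
  have key : ∀ x, x ≠ p → (∀ y ∈ Comp G p x, y ∉ d.K) → ∃ y, y ∉ d.K ∧ d.pr y = p := by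
    intro x hx h
    obtain ⟨b, hb, hbp⟩ := (comp_closed (G := G) p x).exists_adj hG.1.1 ⟨_, comp_self hx⟩
    exact ⟨b, h b hb, (d.adj_out b p hbp (h b hb)).trans (d.pr_id p hp)⟩
  by_cases h : ∀ y ∈ Comp G p a0, y ∉ d.K
  · exact key a0 ha0 h
  · push Not at h
    obtain ⟨y, hy, hyK⟩ := h
    refine key b0 hb0 fun z hz hzK => ?_
    rw [hd] at hyK hzK
    rcases (comp_closed p a0).cycle c hc hyK hy hzK with h | h
    · exact Set.disjoint_left.1 (comp_disjoint hab) h hz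
    · subst h; exact (comp_closed _ b0).1 hz

theorem no_three {V : Type} [Fintype V] {G : SimpleGraph V} (hG : Opt G) (d : Cyc G)
    {p1 p2 p3 : V} (hp1 : p1 ∈ d.K) (hp2 : p2 ∈ d.K) (hp3 : p3 ∈ d.K)
    (h12 : p1 ≠ p2) (h13 : p1 ≠ p3) (h23 : p2 ≠ p3)
    (hb1 : ∃ y, y ∉ d.K ∧ d.pr y = p1) (hb2 : ∃ y, y ∉ d.K ∧ d.pr y = p2)
    (hb3 : ∃ y, y ∉ d.K ∧ d.pr y = p3) : False := by
  by_cases hk : 4 ≤ d.k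
  · exact hG.lol d hk hp1 hp2 hp3 h12 h13 h23 hb1 hb2 hb3
  have hk3 : d.k = 3 := by have := d.hk; omega
  have h01 := d.adj 0 (by omega)
  have h12' := d.adj 1 (by omega)
  have h20 := d.adj0
  rw [hk3] at h20
  norm_num at h01 h12' h20
  have hadj : ∀ p ∈ d.K, ∀ q ∈ d.K, p ≠ q → G.Adj p q := by
    intro p hp q hq hpq
    have h1 := d.idx_lt p hp
    have h2 := d.idx_lt q hq
    have e1 := d.z_idx p hp
    have e2 := d.z_idx q hq
    rw [hk3] at h1 h2
    generalize d.idx p = i at *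
    generalize d.idx q = j at *
    subst e1 e2
    interval_cases i <;> interval_cases j <;> first
      | exact absurd rfl hpq
      | assumption
      | exact SimpleGraph.Adj.symm (by assumption)
  have hdis : ∀ p q : V, p ≠ q →
      Disjoint {y | y ∉ d.K ∧ d.pr y = p} {y | y ∉ d.K ∧ d.pr y = q} := by
    intro p q hpq
    rw [Set.disjoint_left]
    intro y h1 h2
    exact hpq (h1.2.symm.trans h2.2)
  exact hG.triangle (hadj _ hp1 _ hp2 h12) (hadj _ hp1 _ hp3 h13) (hadj _ hp2 _ hp3 h23)
    (A := {y | y ∉ d.K ∧ d.pr y = p1}) (B := {y | y ∉ d.K ∧ d.pr y = p2})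
    (C := {y | y ∉ d.K ∧ d.pr y = p3})
    ((d.lolS 0).closed_G hp1) ((d.lolS 0).closed_G hp2) ((d.lolS 0).closed_G hp3)
    hb1 hb2 hb3 (hdis _ _ h12) (hdis _ _ h13) (hdis _ _ h23)
    (fun h => h.1 hp2) (fun h => h.1 hp3) (fun h => h.1 hp1) (fun h => h.1 hp3)
    (fun h => h.1 hp1) (fun h => h.1 hp2)

theorem block_cuts {V : Type} [Fintype V] {G : SimpleGraph V} (hG : Opt G)
    (hV : 2 ≤ Fintype.card V) {B : Set (Sym2 V)} (hB : IsBlockEdges G B) :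
    {v : V | IsCutVertex G v ∧ ∃ e ∈ B, v ∈ e}.ncard ≤ 2 := by
  obtain ⟨e, he, rfl⟩ := hB
  by_contra hcon
  rw [not_le, Set.two_lt_ncard_iff] at hcon
  obtain ⟨p1, p2, p3, ⟨hc1, f1, ⟨-, hf1⟩, hp1⟩, ⟨hc2, f2, ⟨-, hf2⟩, hp2⟩,
    ⟨hc3, f3, ⟨-, hf3⟩, hp3⟩, h12, h13, h23⟩ := hcon
  by_cases hcy : ∃ (u : V) (c : G.Walk u u), c.IsCycle ∧ e ∈ c.edges
  · obtain ⟨u, c, hc, hec⟩ := hcy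
    have hsup : ∀ f p, SameBlock G e f → p ∈ f → p ∈ c.support := by
      intro f p hf hp
      have hfc : f ∈ c.edges := by
        rcases hf with rfl | ⟨u', c', hc', h1, h2⟩
        · exact hec
        · exact (same_edges hG.1.2 hc hc' hec h1 f).2 h2
      obtain ⟨y, rfl⟩ := Sym2.mem_iff_exists.1 hp
      exact Walk.fst_mem_support_of_mem_edges _ hfc
    obtain ⟨d, hd⟩ := cyc_of hG.1 hc
    have k1 : p1 ∈ d.K := by rw [hd]; exact hsup _ _ hf1 hp1
    have k2 : p2 ∈ d.K := by rw [hd]; exact hsup _ _ hf2 hp2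
    have k3 : p3 ∈ d.K := by rw [hd]; exact hsup _ _ hf3 hp3
    exact no_three hG d k1 k2 k3 h12 h13 h23 (cut_branch hG hV hc d hd k1 hc1)
      (cut_branch hG hV hc d hd k2 hc2) (cut_branch hG hV hc d hd k3 hc3)
  · have heq : ∀ f, SameBlock G e f → e = f := by
      rintro f (h | ⟨u, c, hc, h1, -⟩)
      · exact h
      · exact absurd ⟨u, c, hc, h1⟩ hcy
    obtain rfl := heq _ hf1
    obtain rfl := heq _ hf2
    obtain rfl := heq _ hf3
    induction e using Sym2.ind with
    | _ x y =>
      rw [Sym2.mem_iff] at hp1 hp2 hp3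
      grind

end S16

theorem stmt16 {V : Type} [Fintype V] (n t : ℕ) (hn5 : 5 ≤ n) (ht : 1 ≤ t)
    (hn : 2 * t + 1 ≤ n)
    (G : SimpleGraph V) (hG : IsCactus G)
    (hcard : Fintype.card V = n) (hedges : G.edgeFinset.card = n - 1 + t)
    (hmax : ∀ (W : Type) [Fintype W] (H : SimpleGraph W), IsCactus H →
      Fintype.card W = n → H.edgeFinset.card = n - 1 + t → edgeWiener H ≤ edgeWiener G) :
    (∀ B : Set (Sym2 V), IsBlockEdges G B →
        {v : V | IsCutVertex G v ∧ ∃ e ∈ B, v ∈ e}.ncard ≤ 2) ∧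
      (∀ v : V, IsCutVertex G v →
        {B : Set (Sym2 V) | IsBlockEdges G B ∧ ∃ e ∈ B, v ∈ e}.ncard = 2) := by
  have hO : S16.Opt G := by
    refine ⟨hG, fun H hH hc => ?_⟩
    have h := hmax V H hH hcard (hc.trans hedges)
    unfold edgeWiener at h
    unfold S16.Surg.W2
    omega
  exact ⟨fun B hB => S16.block_cuts hO (by omega) hB,
    fun v hv => S16.cut_blocks hO (by omega) hv⟩
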